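/- arXiv:2303.04567 — 13 statements merged into one kernel-verified Lean document; each statement's English description precedes it below -/
import Mathlib

section
/- Let n ≥ 1 and let p₁, p₂, p₃, p₄ be four pairwise distinct points of ℝ^{n+1} lying on a common affine line that does not pass through the origin. Set xᵢ = pᵢ/‖pᵢ‖ ∈ Sⁿ for i = 1,…,4. Then the spherical cross ratio of x₁, x₂, x₃, x₄ equals the Euclidean cross ratio of p₁, p₂, p₃, p₄, i.e. (sin d(x₂,x₄) · sin d(x₃,x₁)) / (sin d(x₃,x₄) · sin d(x₂,x₁)) = (‖p₂−p₄‖ · ‖p₃−p₁‖) / (‖p₃−p₄‖ · ‖p₂−p₁‖). (In particular, the radial projection of ℝ^{n+1}∖{0} onto Sⁿ is distance-preserving from the timelike Euclidean Hilbert metric to the timelike spherical Hilbert metric, both being half-logarithms of these cross ratios.) -/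
open scoped RealInnerProductSpace

/-- `sin` of the spherical distance `arccos ⟨x, y⟩` between two points of the unit sphere. -/
noncomputable def sphSin {n : ℕ} (x y : EuclideanSpace ℝ (Fin (n + 1))) : ℝ :=
  Real.sin (Real.arccos ⟪x, y⟫)

/-- For two points `q + a • v`, `q + b • v` of a line, the sine of the spherical distance between
their radial projections is `|a - b|` times a constant of the line, divided by their norms. -/
lemma sphSin_smul_line {n : ℕ} (q v x y : EuclideanSpace ℝ (Fin (n + 1))) (a b : ℝ)
    (hx : x = a • v + q) (hy : y = b • v + q) (hx0 : x ≠ 0) (hy0 : y ≠ 0) :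
    sphSin (‖x‖⁻¹ • x) (‖y‖⁻¹ • y)
      = |a - b| * √(‖q‖ ^ 2 * ‖v‖ ^ 2 - ⟪q, v⟫ ^ 2) / (‖x‖ * ‖y‖) := by
  have hxn : 0 < ‖x‖ := norm_pos_iff.2 hx0
  have hyn : 0 < ‖y‖ := norm_pos_iff.2 hy0
  have gram : ‖x‖ ^ 2 * ‖y‖ ^ 2 - ⟪x, y⟫ ^ 2
      = (a - b) ^ 2 * (‖q‖ ^ 2 * ‖v‖ ^ 2 - ⟪q, v⟫ ^ 2) := by
    simp only [← real_inner_self_eq_norm_sq, hx, hy, inner_add_left, inner_add_right,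
      real_inner_smul_left, real_inner_smul_right, real_inner_comm q v]
    ring
  have key : 1 - ⟪‖x‖⁻¹ • x, ‖y‖⁻¹ • y⟫ ^ 2
      = (a - b) ^ 2 * (‖q‖ ^ 2 * ‖v‖ ^ 2 - ⟪q, v⟫ ^ 2) / (‖x‖ * ‖y‖) ^ 2 := by
    rw [← gram, real_inner_smul_left, real_inner_smul_right]
    field_simp
  rw [sphSin, Real.sin_arccos, key, Real.sqrt_div' _ (by positivity),
    Real.sqrt_mul (sq_nonneg _), Real.sqrt_sq_eq_abs, Real.sqrt_sq (by positivity)]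

/-- If no point of the line `q + ℝ v` is zero, the Gram determinant of `q` and `v` is positive. -/
lemma gram_pos_of_line_ne_zero {E : Type*} [NormedAddCommGroup E] [InnerProductSpace ℝ E]
    (q v : E) (hv : v ≠ 0) (h : ∀ s : ℝ, s • v + q ≠ 0) :
    0 < ‖q‖ ^ 2 * ‖v‖ ^ 2 - ⟪q, v⟫ ^ 2 := by
  have hvn : 0 < ‖v‖ := norm_pos_iff.2 hv
  have hpos : 0 < ‖(-⟪q, v⟫ / ‖v‖ ^ 2) • v + q‖ ^ 2 * ‖v‖ ^ 2 :=
    mul_pos (pow_pos (norm_pos_iff.2 (h _)) 2) (by positivity)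
  convert hpos using 1
  rw [norm_add_sq_real, norm_smul, mul_pow, Real.norm_eq_abs, sq_abs, real_inner_smul_left,
    real_inner_comm q v]
  field_simp
  ring

/-- The radial projection to the sphere sends the Euclidean cross ratio of four distinct
collinear points (on a line avoiding the origin) to the spherical cross ratio. -/
theorem stmt_0 (n : ℕ) (hn : 1 ≤ n)
    (p₁ p₂ p₃ p₄ x₁ x₂ x₃ x₄ : EuclideanSpace ℝ (Fin (n + 1)))
    (h12 : p₁ ≠ p₂) (h13 : p₁ ≠ p₃) (h14 : p₁ ≠ p₄)
    (h23 : p₂ ≠ p₃) (h24 : p₂ ≠ p₄) (h34 : p₃ ≠ p₄)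
    (hcol : Collinear ℝ ({p₁, p₂, p₃, p₄} : Set (EuclideanSpace ℝ (Fin (n + 1)))))
    (h0 : (0 : EuclideanSpace ℝ (Fin (n + 1))) ∉
      affineSpan ℝ ({p₁, p₂, p₃, p₄} : Set (EuclideanSpace ℝ (Fin (n + 1)))))
    (hx₁ : x₁ = ‖p₁‖⁻¹ • p₁) (hx₂ : x₂ = ‖p₂‖⁻¹ • p₂)
    (hx₃ : x₃ = ‖p₃‖⁻¹ • p₃) (hx₄ : x₄ = ‖p₄‖⁻¹ • p₄) :
    (sphSin x₂ x₄ * sphSin x₃ x₁) / (sphSin x₃ x₄ * sphSin x₂ x₁)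
      = (‖p₂ - p₄‖ * ‖p₃ - p₁‖) / (‖p₃ - p₄‖ * ‖p₂ - p₁‖) := by
  obtain ⟨v, hv⟩ := (collinear_iff_of_mem (p₀ := p₁) (by simp)).1 hcol
  obtain ⟨a₁, e₁⟩ := hv p₁ (by simp)
  obtain ⟨a₂, e₂⟩ := hv p₂ (by simp)
  obtain ⟨a₃, e₃⟩ := hv p₃ (by simp)
  obtain ⟨a₄, e₄⟩ := hv p₄ (by simp)
  rw [vadd_eq_add] at e₁ e₂ e₃ e₄
  have ne_zero : ∀ p ∈ ({p₁, p₂, p₃, p₄} : Set (EuclideanSpace ℝ (Fin (n + 1)))), p ≠ 0 :=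
    fun p hp hp0 => h0 (hp0 ▸ subset_affineSpan ℝ _ hp)
  have n₁ : p₁ ≠ 0 := ne_zero p₁ (by simp)
  have n₂ : p₂ ≠ 0 := ne_zero p₂ (by simp)
  have n₃ : p₃ ≠ 0 := ne_zero p₃ (by simp)
  have n₄ : p₄ ≠ 0 := ne_zero p₄ (by simp)
  have hv0 : v ≠ 0 := by
    rintro rfl
    exact h12 (by simpa using e₂.symm)
  have ha₂ : a₂ ≠ 0 := by
    rintro rfl
    exact h12 (by simpa using e₂.symm)
  have hline : ∀ s : ℝ, s • v + p₁ ≠ 0 := by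
    intro s hs
    apply h0
    have hmem := AffineMap.lineMap_mem (s / a₂)
      (subset_affineSpan ℝ ({p₁, p₂, p₃, p₄} : Set (EuclideanSpace ℝ (Fin (n + 1))))
        (by simp : p₁ ∈ _))
      (subset_affineSpan ℝ ({p₁, p₂, p₃, p₄} : Set (EuclideanSpace ℝ (Fin (n + 1))))
        (by simp : p₂ ∈ _))
    have hd : p₂ - p₁ = a₂ • v := sub_eq_of_eq_add e₂
    rwa [AffineMap.lineMap_apply, vsub_eq_sub, vadd_eq_add, hd, smul_smul,
      div_mul_cancel₀ _ ha₂, hs] at hmem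
  have hA := Real.sqrt_pos.2 (gram_pos_of_line_ne_zero p₁ v hv0 hline)
  have dist_eq : ∀ (x y : EuclideanSpace ℝ (Fin (n + 1))) (a b : ℝ), x = a • v + p₁ →
      y = b • v + p₁ → ‖x - y‖ = |a - b| * ‖v‖ := by
    rintro x y a b rfl rfl
    rw [add_sub_add_right_eq_sub, ← sub_smul, norm_smul, Real.norm_eq_abs]
  have hvn := norm_pos_iff.2 hv0
  have m₁ := norm_pos_iff.2 n₁
  have m₂ := norm_pos_iff.2 n₂
  have m₃ := norm_pos_iff.2 n₃
  have m₄ := norm_pos_iff.2 n₄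
  have d34 : 0 < |a₃ - a₄| := abs_pos.2 fun h => h34 (e₃.trans (sub_eq_zero.1 h ▸ e₄.symm))
  have d21 : 0 < |a₂ - a₁| := abs_pos.2 fun h =>
    h12 (e₁.trans (sub_eq_zero.1 h ▸ e₂.symm))
  rw [hx₁, hx₂, hx₃, hx₄, sphSin_smul_line p₁ v p₂ p₄ a₂ a₄ e₂ e₄ n₂ n₄,
    sphSin_smul_line p₁ v p₃ p₁ a₃ a₁ e₃ e₁ n₃ n₁,
    sphSin_smul_line p₁ v p₃ p₄ a₃ a₄ e₃ e₄ n₃ n₄,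
    sphSin_smul_line p₁ v p₂ p₁ a₂ a₁ e₂ e₁ n₂ n₁,
    dist_eq _ _ _ _ e₂ e₄, dist_eq _ _ _ _ e₃ e₁, dist_eq _ _ _ _ e₃ e₄, dist_eq _ _ _ _ e₂ e₁]
  generalize √(‖p₁‖ ^ 2 * ‖v‖ ^ 2 - ⟪p₁, v⟫ ^ 2) = A at hA ⊢
  field_simp
end

section
/- Let n ≥ 1, let L : ℝ^{n+1} → ℝ^{n+1} be an invertible linear map, and let x₁, x₂, x₃, x₄ be four points of Sⁿ lying in a common 2-dimensional linear subspace of ℝ^{n+1} (i.e. on a common great circle), such that xᵢ ≠ xⱼ and xᵢ ≠ −xⱼ for all i ≠ j. Set yᵢ = L(xᵢ)/‖L(xᵢ)‖ ∈ Sⁿ. Then the spherical cross ratio is preserved: (sin d(y₂,y₄) · sin d(y₃,y₁)) / (sin d(y₃,y₄) · sin d(y₂,y₁)) = (sin d(x₂,x₄) · sin d(x₃,x₁)) / (sin d(x₃,x₄) · sin d(x₂,x₁)). (This is the key invariance underlying the fact that projective transformations of the sphere preserving the two convex hypersurfaces are isometries of the timelike spherical Hilbert metric.) -/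
open scoped RealInnerProductSpace

section Parallelogram

variable {E F : Type*} [NormedAddCommGroup E] [InnerProductSpace ℝ E]
  [NormedAddCommGroup F] [InnerProductSpace ℝ F]

/-- The area of the parallelogram spanned by two vectors. -/
noncomputable def parallelogramArea (u v : E) : ℝ :=
  √(⟪u, u⟫ * ⟪v, v⟫ - ⟪u, v⟫ ^ 2)

theorem parallelogramArea_comb (p q : E) (a b c d : ℝ) :
    parallelogramArea (a • p + b • q) (c • p + d • q)
      = |a * d - b * c| * parallelogramArea p q := by
  unfold parallelogramArea
  rw [← Real.sqrt_sq_eq_abs, ← Real.sqrt_mul (sq_nonneg _)]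
  congr 1
  simp only [inner_add_left, inner_add_right, real_inner_smul_left, real_inner_smul_right,
    real_inner_comm p q]
  ring

theorem parallelogramArea_smul (u v : E) {a b : ℝ} (ha : 0 ≤ a) (hb : 0 ≤ b) :
    parallelogramArea (a • u) (b • v) = a * b * parallelogramArea u v := by
  simpa [abs_of_nonneg (mul_nonneg ha hb)] using parallelogramArea_comb u v a 0 0 b

theorem parallelogramArea_pos {p q : E} (h : LinearIndependent ℝ ![p, q]) :
    0 < parallelogramArea p q := by
  have hp : p ≠ 0 := h.ne_zero 0
  refine Real.sqrt_pos.2 (not_le.1 fun hle => ?_)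
  have hz : (-⟪p, q⟫) • p + ⟪p, p⟫ • q = 0 := by
    rw [← real_inner_self_nonpos]
    have key : ⟪(-⟪p, q⟫) • p + ⟪p, p⟫ • q, (-⟪p, q⟫) • p + ⟪p, p⟫ • q⟫
        = ⟪p, p⟫ * (⟪p, p⟫ * ⟪q, q⟫ - ⟪p, q⟫ ^ 2) := by
      simp only [inner_add_left, inner_add_right, real_inner_smul_left, real_inner_smul_right,
        real_inner_comm p q]
      ring
    rw [key]
    exact mul_nonpos_of_nonneg_of_nonpos (real_inner_self_nonneg (x := p)) (by linarith)
  exact hp (inner_self_eq_zero.1 (LinearIndependent.pair_iff.1 h _ _ hz).2)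

/-- An injective linear map scales all parallelogram areas in a plane by the same factor. -/
theorem exists_parallelogramArea_map_eq (L : E →ₗ[ℝ] F) (hL : Function.Injective L)
    (P : Submodule ℝ E) (hP : Module.finrank ℝ P = 2) :
    ∃ k : ℝ, 0 < k ∧ ∀ u ∈ P, ∀ v ∈ P,
      parallelogramArea (L u) (L v) = k * parallelogramArea u v := by
  have : Module.Finite ℝ P := Module.finite_of_finrank_pos (by omega)
  let b := Module.finBasisOfFinrankEq ℝ P hP
  have hb : LinearIndependent ℝ ![(b 0 : E), (b 1 : E)] := by
    have h : ![(b 0 : E), (b 1 : E)] = P.subtype ∘ b := by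
      ext i
      fin_cases i <;> rfl
    exact h ▸ b.linearIndependent.map' P.subtype P.ker_subtype
  have hLb : LinearIndependent ℝ ![L (b 0), L (b 1)] := by
    have h : ![L (b 0), L (b 1)] = L ∘ ![(b 0 : E), (b 1 : E)] := by
      ext i
      fin_cases i <;> rfl
    exact h ▸ hb.map' L (LinearMap.ker_eq_bot.2 hL)
  have hpos := parallelogramArea_pos hb
  have hrepr (w : E) (hw : w ∈ P) : ∃ s t : ℝ, w = s • (b 0 : E) + t • (b 1 : E) := by
    refine ⟨b.repr ⟨w, hw⟩ 0, b.repr ⟨w, hw⟩ 1, ?_⟩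
    have h := b.sum_repr ⟨w, hw⟩
    rw [Fin.sum_univ_two] at h
    exact (congrArg Subtype.val h).symm
  refine ⟨_, div_pos (parallelogramArea_pos hLb) hpos, fun u hu v hv => ?_⟩
  obtain ⟨s, t, rfl⟩ := hrepr u hu
  obtain ⟨s', t', rfl⟩ := hrepr v hv
  simp only [map_add, map_smul, parallelogramArea_comb]
  field_simp

end Parallelogram

theorem sphSin_eq_parallelogramArea {n : ℕ} {u v : EuclideanSpace ℝ (Fin (n + 1))}
    (hu : ‖u‖ = 1) (hv : ‖v‖ = 1) : sphSin u v = parallelogramArea u v := by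
  simp [sphSin, parallelogramArea, Real.sin_arccos, hu, hv]

/-- Projective transformations of the sphere (induced by invertible linear maps) preserve
the spherical cross ratio of four points on a common great circle, no two of which are
equal or antipodal. -/
theorem stmt_1 (n : ℕ) (hn : 1 ≤ n)
    (L : EuclideanSpace ℝ (Fin (n + 1)) ≃ₗ[ℝ] EuclideanSpace ℝ (Fin (n + 1)))
    (x y : Fin 4 → EuclideanSpace ℝ (Fin (n + 1)))
    (hsphere : ∀ i, ‖x i‖ = 1)
    (hplane : ∃ P : Submodule ℝ (EuclideanSpace ℝ (Fin (n + 1))),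
      Module.finrank ℝ P = 2 ∧ ∀ i, x i ∈ P)
    (hne : ∀ i j, i ≠ j → x i ≠ x j ∧ x i ≠ -x j)
    (hy : ∀ i, y i = ‖L (x i)‖⁻¹ • L (x i)) :
    (sphSin (y 1) (y 3) * sphSin (y 2) (y 0)) / (sphSin (y 2) (y 3) * sphSin (y 1) (y 0))
      = (sphSin (x 1) (x 3) * sphSin (x 2) (x 0))
        / (sphSin (x 2) (x 3) * sphSin (x 1) (x 0)) := by
  obtain ⟨P, hP, hxP⟩ := hplane
  obtain ⟨k, hk, hmap⟩ := exists_parallelogramArea_map_eq L.toLinearMap L.injective P hP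
  have hpos (i) : 0 < ‖L (x i)‖ := by
    have hx : x i ≠ 0 := norm_ne_zero_iff.1 (by simp [hsphere i])
    simpa using hx
  have hynorm (i) : ‖y i‖ = 1 := by
    rw [hy, norm_smul, norm_inv, norm_norm, inv_mul_cancel₀ (hpos i).ne']
  have hsin (i j) :
      sphSin (y i) (y j) = ‖L (x i)‖⁻¹ * ‖L (x j)‖⁻¹ * k * sphSin (x i) (x j) := by
    have hij : parallelogramArea (L (x i)) (L (x j)) = k * parallelogramArea (x i) (x j) :=
      hmap _ (hxP i) _ (hxP j)
    rw [sphSin_eq_parallelogramArea (hynorm i) (hynorm j),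
      sphSin_eq_parallelogramArea (hsphere i) (hsphere j), hy, hy,
      parallelogramArea_smul _ _ (by positivity) (by positivity), hij]
    ring
  set c : ℝ := k ^ 2 * (‖L (x 0)‖⁻¹ * ‖L (x 1)‖⁻¹ * ‖L (x 2)‖⁻¹ * ‖L (x 3)‖⁻¹) with hc
  have hc0 : c ≠ 0 := by
    have := hpos 0; have := hpos 1; have := hpos 2; have := hpos 3
    positivity
  rw [← mul_div_mul_left (sphSin (x 1) (x 3) * sphSin (x 2) (x 0)) _ hc0]
  simp only [hsin, hc]
  congr 1 <;> ring
end

section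
/- Let n ≥ 1 and let I₁, I₂ be nonempty open subsets of Sⁿ (the unit sphere in ℝ^{n+1}) such that, for i = 1, 2, the cone Cᵢ = {r·x : r > 0, x ∈ Iᵢ} is convex and contains no antipodal pair of directions (equivalently, Iᵢ is an open convex subset of Sⁿ contained in an open hemisphere). Let Kᵢ be the frontier of Iᵢ in Sⁿ, and assume K₁ and K₂ are in good position, i.e.: (1) the closures of I₁ and I₂ are disjoint; (2) for every 2-dimensional linear subspace P of ℝ^{n+1} such that the great circle P ∩ Sⁿ meets both K₁ and K₂, the set (P ∩ Sⁿ) ∖ (closure(I₁) ∪ closure(I₂)) is the union of two disjoint open arcs of great circle, each of spherical length < π. Then there exists a point x ∈ I₁ with −x ∈ I₂. -/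
open scoped RealInnerProductSpace

/-- The open cone over a subset `I` of the unit sphere: all positive multiples of points
of `I`. -/
def radialCone {n : ℕ} (I : Set (EuclideanSpace ℝ (Fin (n + 1)))) :
    Set (EuclideanSpace ℝ (Fin (n + 1))) :=
  {y | ∃ r : ℝ, 0 < r ∧ ∃ x ∈ I, y = r • x}

/-- `A` is an open arc of great circle of spherical length `ℓ`, i.e. of the form
`{cos t • a + sin t • b : 0 < t < ℓ}` for orthonormal vectors `a`, `b`. -/
def IsOpenArc {n : ℕ} (A : Set (EuclideanSpace ℝ (Fin (n + 1)))) (ℓ : ℝ) : Prop :=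
  ∃ a b : EuclideanSpace ℝ (Fin (n + 1)), ‖a‖ = 1 ∧ ‖b‖ = 1 ∧ ⟪a, b⟫ = 0 ∧
    A = {x | ∃ t : ℝ, 0 < t ∧ t < ℓ ∧ x = Real.cos t • a + Real.sin t • b}

theorem mem_radialCone_iff {n : ℕ} {I : Set (EuclideanSpace ℝ (Fin (n + 1)))}
    (hI : I ⊆ Metric.sphere 0 1) {y : EuclideanSpace ℝ (Fin (n + 1))} :
    y ∈ radialCone I ↔ y ≠ 0 ∧ ‖y‖⁻¹ • y ∈ I := by
  constructor
  · rintro ⟨r, hr, x, hx, rfl⟩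
    have hx1 : ‖x‖ = 1 := by simpa using hI hx
    have hx0 : x ≠ 0 := by
      rintro rfl
      simp at hx1
    refine ⟨smul_ne_zero hr.ne' hx0, ?_⟩
    rw [norm_smul, hx1, Real.norm_of_nonneg hr.le, smul_smul]
    simpa [hr.ne'] using hx
  · rintro ⟨hy, hI'⟩
    refine ⟨‖y‖, norm_pos_iff.2 hy, _, hI', ?_⟩
    rw [smul_smul, mul_inv_cancel₀ (norm_ne_zero_iff.2 hy), one_smul]

theorem continuousOn_normalize {E : Type*} [NormedAddCommGroup E] [NormedSpace ℝ E] :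
    ContinuousOn (fun y : E => ‖y‖⁻¹ • y) {0}ᶜ :=
  (continuousOn_id.norm.inv₀ fun _ hy => norm_ne_zero_iff.2 hy).smul continuousOn_id

theorem isOpen_radialCone {n : ℕ} {I U : Set (EuclideanSpace ℝ (Fin (n + 1)))}
    (hU : IsOpen U) (hI : I = U ∩ Metric.sphere 0 1) : IsOpen (radialCone I) := by
  have h := continuousOn_normalize.isOpen_inter_preimage
    (isOpen_compl_singleton (x := (0 : EuclideanSpace ℝ (Fin (n + 1))))) hU
  refine (congrArg IsOpen (Set.ext fun y => ?_)).mpr h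
  rw [mem_radialCone_iff (hI ▸ Set.inter_subset_right), hI]
  simp only [Set.mem_inter_iff, Set.mem_compl_iff, Set.mem_singleton_iff, Set.mem_preimage]
  refine and_congr_right fun hy => and_iff_left ?_
  simp [norm_smul, hy]

/-- The trace on the unit sphere of a convex set avoiding the origin and stable under positive
scaling is preconnected. -/
theorem isPreconnected_inter_sphere {E : Type*} [NormedAddCommGroup E] [NormedSpace ℝ E]
    {s : Set E} (hs : Convex ℝ s) (h0 : (0 : E) ∉ s)
    (hsmul : ∀ r : ℝ, 0 < r → ∀ x ∈ s, r • x ∈ s) :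
    IsPreconnected (s ∩ Metric.sphere 0 1) := by
  have hne : ∀ x ∈ s, x ≠ 0 := fun x hx h => h0 (h ▸ hx)
  convert hs.isPreconnected.image (fun y : E => ‖y‖⁻¹ • y) (continuousOn_normalize.mono hne)
    using 1
  ext y
  constructor
  · rintro ⟨hy, hy1⟩
    refine ⟨y, hy, ?_⟩
    simp only [mem_sphere_zero_iff_norm] at hy1
    simp [hy1]
  · rintro ⟨x, hx, rfl⟩
    have := hne x hx
    exact ⟨hsmul _ (by positivity) x hx, by simp [norm_smul, this]⟩

theorem exists_mem_closure_diff {X : Type*} [TopologicalSpace X] {S H I U : Set X}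
    (hH : IsPreconnected H) (hHS : H ⊆ S) (hU : IsOpen U) (hI : I = U ∩ S)
    (hp : (H ∩ I).Nonempty) (hq : (H ∩ (closure I)ᶜ).Nonempty) :
    ∃ k ∈ H, k ∈ closure I \ I := by
  by_contra! hcon
  have hsub : H ⊆ U ∪ (closure I)ᶜ := by
    intro x hx
    by_cases hxc : x ∈ closure I
    · have hxI : x ∈ I := by_contra fun h => hcon x hx ⟨hxc, h⟩
      exact Or.inl (hI ▸ hxI).1
    · exact Or.inr hxc
  obtain ⟨x, hx, hxU, hxc⟩ := hH U (closure I)ᶜ hU isClosed_closure.isOpen_compl hsub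
    (hp.mono fun x hx => ⟨hx.1, (hI ▸ hx.2).1⟩) hq
  exact hxc (subset_closure (by rw [hI]; exact ⟨hxU, hHS hx⟩))

/-- Two disjoint open convex cones, one of them reflected, lie in a common open half-space. -/
theorem exists_common_halfSpace {n : ℕ} {I₁ I₂ : Set (EuclideanSpace ℝ (Fin (n + 1)))}
    (hne₁ : I₁.Nonempty) (hne₂ : I₂.Nonempty)
    (ho₁ : IsOpen (radialCone I₁)) (ho₂ : IsOpen (radialCone I₂))
    (hconv₁ : Convex ℝ (radialCone I₁)) (hconv₂ : Convex ℝ (radialCone I₂))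
    (hdisj : Disjoint (radialCone I₁) (-radialCone I₂)) :
    ∃ f : StrongDual ℝ (EuclideanSpace ℝ (Fin (n + 1))),
      (∀ x ∈ I₁, 0 < f x) ∧ ∀ x ∈ I₂, 0 < f x := by
  obtain ⟨f, s, h₁, h₂⟩ :=
    geometric_hahn_banach_open_open hconv₁ ho₁ hconv₂.neg ho₂.neg hdisj
  have k₁ : ∀ x ∈ I₁, ∀ r : ℝ, 0 < r → r * f x < s := fun x hx r hr => by
    simpa using h₁ (r • x) ⟨r, hr, x, hx, rfl⟩
  have k₂ : ∀ x ∈ I₂, ∀ r : ℝ, 0 < r → r * f x < -s := fun x hx r hr => by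
    have := h₂ (-(r • x)) (by simpa using ⟨r, hr, x, hx, rfl⟩)
    simp only [map_neg, map_smul, smul_eq_mul] at this
    linarith
  have key : ∀ c t : ℝ, (∀ r : ℝ, 0 < r → r * c < t) → 0 ≤ t := fun c t h => by
    by_contra! ht
    have hc : c < 0 := by linarith [h 1 one_pos]
    have hr : 0 < t / c / 2 := by have := div_pos_of_neg_of_neg ht hc; positivity
    have := h _ hr
    have e : t / c / 2 * c = t / 2 := by rw [div_right_comm, div_mul_cancel₀ _ hc.ne]
    linarith
  obtain ⟨p, hp⟩ := hne₁
  obtain ⟨q, hq⟩ := hne₂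
  have hs₁ := key _ _ (k₁ p hp)
  have hs₂ := key _ _ (k₂ q hq)
  have hs : s = 0 := by linarith
  subst hs
  refine ⟨-f, fun x hx => ?_, fun x hx => ?_⟩
  · simpa using k₁ x hx 1 one_pos
  · simpa using k₂ x hx 1 one_pos

/-- A nonempty open arc of length less than `π` in the great circle of `P` is cut out by two
open half-spaces whose boundaries meet `P` only at the origin. -/
theorem IsOpenArc.exists_halfSpaces {n : ℕ} {A : Set (EuclideanSpace ℝ (Fin (n + 1)))} {ℓ : ℝ}
    (hA : IsOpenArc A ℓ) (hℓ : ℓ < Real.pi) (hne : A.Nonempty)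
    {P : Submodule ℝ (EuclideanSpace ℝ (Fin (n + 1)))} (hP : Module.finrank ℝ P = 2)
    (hAP : A ⊆ P) :
    ∃ u v : EuclideanSpace ℝ (Fin (n + 1)),
      (∀ x ∈ (P : Set _) ∩ Metric.sphere 0 1, x ∈ A ↔ 0 < ⟪u, x⟫ ∧ 0 < ⟪v, x⟫) ∧
      ∀ w ∈ P, ⟪u, w⟫ = 0 → ⟪v, w⟫ = 0 → w = 0 := by
  obtain ⟨a, b, ha, hb, hab, rfl⟩ := hA
  obtain ⟨_, t₀, ht₀, ht₀ℓ, -⟩ := hne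
  have hℓ0 : 0 < ℓ := ht₀.trans ht₀ℓ
  have hba : ⟪b, a⟫ = 0 := by rw [real_inner_comm, hab]
  have haa : ⟪a, a⟫ = 1 := by rw [real_inner_self_eq_norm_sq, ha]; norm_num
  have hbb : ⟪b, b⟫ = 1 := by rw [real_inner_self_eq_norm_sq, hb]; norm_num
  have hmem : ∀ t, 0 < t → t < ℓ → Real.cos t • a + Real.sin t • b ∈ P :=
    fun t h0 h1 => hAP ⟨t, h0, h1, rfl⟩
  have hx := hmem (ℓ / 2) (by linarith) (by linarith)
  have hy := hmem (ℓ / 3) (by linarith) (by linarith)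
  have hsin : Real.sin (ℓ / 2 - ℓ / 3) ≠ 0 :=
    (Real.sin_pos_of_pos_of_lt_pi (by linarith) (by linarith)).ne'
  have haP : a ∈ P := by
    rw [← P.smul_mem_iff hsin]
    convert P.sub_mem (P.smul_mem (Real.sin (ℓ / 2)) hy) (P.smul_mem (Real.sin (ℓ / 3)) hx)
      using 1
    rw [Real.sin_sub]
    module
  have hbP : b ∈ P := by
    rw [← P.smul_mem_iff hsin]
    convert P.sub_mem (P.smul_mem (Real.cos (ℓ / 3)) hx) (P.smul_mem (Real.cos (ℓ / 2)) hy)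
      using 1
    rw [Real.sin_sub]
    module
  have hli : LinearIndependent ℝ ![a, b] := by
    rw [LinearIndependent.pair_iff]
    intro s t hst
    have h1 := congrArg (fun z => ⟪a, z⟫) hst
    have h2 := congrArg (fun z => ⟪b, z⟫) hst
    simp only [inner_add_right, inner_smul_right, haa, hab, hba, hbb, inner_zero_right] at h1 h2
    constructor <;> linarith
  have hspan : Submodule.span ℝ {a, b} = P := by
    refine Submodule.eq_of_le_of_finrank_eq ?_ ?_
    · rw [Submodule.span_le]
      rintro x (rfl | rfl)
      exacts [haP, hbP]
    · have := finrank_span_eq_card hli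
      rw [Matrix.range_cons_cons_empty] at this
      simpa [hP] using this
  have hsinℓ : 0 < Real.sin ℓ := Real.sin_pos_of_pos_of_lt_pi hℓ0 hℓ
  refine ⟨b, Real.sin ℓ • a - Real.cos ℓ • b, ?_, ?_⟩
  · rintro x ⟨hxP, hx1⟩
    rw [SetLike.mem_coe, ← hspan, Submodule.mem_span_pair] at hxP
    obtain ⟨c, s, rfl⟩ := hxP
    have hcs : c ^ 2 + s ^ 2 = 1 := by
      have h : ⟪c • a + s • b, c • a + s • b⟫ = 1 := by
        rw [real_inner_self_eq_norm_sq, mem_sphere_zero_iff_norm.1 hx1]; norm_num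
      simp only [inner_add_right, inner_add_left, inner_smul_right, real_inner_smul_left, haa,
        hab, hba, hbb] at h
      linarith
    simp only [inner_add_right, inner_sub_left, inner_smul_right, real_inner_smul_left, haa,
      hab, hba, hbb]
    constructor
    · rintro ⟨t, h0, h1, he⟩
      have e1 := congrArg (fun z => ⟪a, z⟫) he
      have e2 := congrArg (fun z => ⟪b, z⟫) he
      simp only [inner_add_right, inner_smul_right, haa, hab, hba, hbb] at e1 e2
      have hc : c = Real.cos t := by linarith
      have hs : s = Real.sin t := by linarith
      have p1 := Real.sin_pos_of_pos_of_lt_pi h0 (h1.trans hℓ)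
      have p2 := Real.sin_pos_of_pos_of_lt_pi (sub_pos.2 h1) (by linarith)
      rw [Real.sin_sub] at p2
      subst hc hs
      constructor <;> linarith
    · rintro ⟨hs, hv⟩
      have hs : 0 < s := by linarith
      have hcos : Real.cos (Real.arccos c) = c :=
        Real.cos_arccos (by nlinarith) (by nlinarith)
      have hsn : Real.sin (Real.arccos c) = s := by
        rw [Real.sin_arccos, show 1 - c ^ 2 = s ^ 2 by linarith, Real.sqrt_sq hs.le]
      refine ⟨Real.arccos c, Real.arccos_pos.2 (by nlinarith), ?_, by rw [hcos, hsn]⟩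
      by_contra! hle
      have := Real.sin_nonneg_of_nonneg_of_le_pi (sub_nonneg.2 hle)
        (by linarith [Real.arccos_le_pi c])
      rw [Real.sin_sub, hcos, hsn] at this
      linarith
  · intro w hw h1 h2
    rw [← hspan, Submodule.mem_span_pair] at hw
    obtain ⟨c, s, rfl⟩ := hw
    simp only [inner_add_right, inner_sub_left, inner_smul_right, real_inner_smul_left, haa,
      hab, hba, hbb] at h1 h2
    have hs : s = 0 := by linarith
    subst hs
    have hc : c = 0 := by
      have : Real.sin ℓ * c = 0 := by linarith
      exact (mul_eq_zero.1 this).resolve_left hsinℓ.ne'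
    simp [hc]

/-- An open half great circle is not contained in an arc of length less than `π`. -/
theorem IsOpenArc.not_halfCircle_subset {n : ℕ} {A : Set (EuclideanSpace ℝ (Fin (n + 1)))}
    {ℓ : ℝ} (hA : IsOpenArc A ℓ) (hℓ : ℓ < Real.pi)
    {P : Submodule ℝ (EuclideanSpace ℝ (Fin (n + 1)))} (hP : Module.finrank ℝ P = 2)
    (hAP : A ⊆ P) (f : StrongDual ℝ (EuclideanSpace ℝ (Fin (n + 1))))
    {k w : EuclideanSpace ℝ (Fin (n + 1))} (hk : k ∈ P) (hfk : f k < 0) (hw : w ∈ P)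
    (hw0 : w ≠ 0) (hfw : f w = 0) :
    ¬ ((P : Set _) ∩ {x | f x < 0}) ∩ Metric.sphere 0 1 ⊆ A := by
  intro hsub
  have hnorm : ∀ y ∈ P, f y < 0 →
      ‖y‖⁻¹ • y ∈ (P : Set _) ∩ {x | f x < 0} ∩ Metric.sphere 0 1 ∧ 0 < ‖y‖⁻¹ := by
    intro y hy hfy
    have hy0 : y ≠ 0 := by rintro rfl; simp at hfy
    have hpos : 0 < ‖y‖⁻¹ := by positivity
    refine ⟨⟨⟨P.smul_mem _ hy, ?_⟩, by simp [norm_smul, hy0]⟩, hpos⟩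
    simpa using mul_neg_of_pos_of_neg hpos hfy
  obtain ⟨u, v, huv, hzero⟩ :=
    hA.exists_halfSpaces hℓ ⟨_, hsub (hnorm k hk hfk).1⟩ hP hAP
  have hpos : ∀ y ∈ P, f y < 0 → 0 < ⟪u, y⟫ ∧ 0 < ⟪v, y⟫ := by
    intro y hy hfy
    obtain ⟨hm, hp⟩ := hnorm y hy hfy
    have := (huv _ ⟨hm.1.1, hm.2⟩).1 (hsub hm)
    simpa only [inner_smul_right, mul_pos_iff_of_pos_left hp] using this
  have hlim : ∀ z, f z = 0 → z ∈ P → 0 ≤ ⟪u, z⟫ ∧ 0 ≤ ⟪v, z⟫ := by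
    intro z hz hzP
    have h : ∀ ε : ℝ, 0 < ε → 0 < ⟪u, z⟫ + ε * ⟪u, k⟫ ∧ 0 < ⟪v, z⟫ + ε * ⟪v, k⟫ := by
      intro ε hε
      have := hpos (z + ε • k) (P.add_mem hzP (P.smul_mem _ hk))
        (by simpa [hz] using mul_neg_of_pos_of_neg hε hfk)
      simpa only [inner_add_right, inner_smul_right] using this
    obtain ⟨hu, hv⟩ := hpos k hk hfk
    constructor
    · refine le_of_forall_pos_lt_add fun δ hδ => ?_
      have := (h (δ / ⟪u, k⟫) (by positivity)).1
      rwa [div_mul_cancel₀ _ hu.ne'] at this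
    · refine le_of_forall_pos_lt_add fun δ hδ => ?_
      have := (h (δ / ⟪v, k⟫) (by positivity)).2
      rwa [div_mul_cancel₀ _ hv.ne'] at this
  have h1 := hlim w hfw hw
  have h2 := hlim (-w) (by simp [hfw]) (P.neg_mem hw)
  simp only [inner_neg_right] at h2
  exact hw0 (hzero w hw (by linarith [h1.1, h2.1]) (by linarith [h1.2, h2.2]))

/-- A preconnected part of a great circle covered by two disjoint open arcs of length less
than `π` lies in one of them. -/
theorem IsOpenArc.subset_or_subset {n : ℕ} {A₁ A₂ N : Set (EuclideanSpace ℝ (Fin (n + 1)))}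
    {ℓ₁ ℓ₂ : ℝ} (hA₁ : IsOpenArc A₁ ℓ₁) (hA₂ : IsOpenArc A₂ ℓ₂) (hℓ₁ : ℓ₁ < Real.pi)
    (hℓ₂ : ℓ₂ < Real.pi) (hdisj : Disjoint A₁ A₂)
    {P : Submodule ℝ (EuclideanSpace ℝ (Fin (n + 1)))} (hP : Module.finrank ℝ P = 2)
    (h₁ : A₁ ⊆ P) (h₂ : A₂ ⊆ P) (hN : IsPreconnected N)
    (hNP : N ⊆ (P : Set _) ∩ Metric.sphere 0 1) (hcov : N ⊆ A₁ ∪ A₂) :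
    N ⊆ A₁ ∨ N ⊆ A₂ := by
  have hopen : ∀ {A : Set (EuclideanSpace ℝ (Fin (n + 1)))} {ℓ : ℝ}, IsOpenArc A ℓ →
      ℓ < Real.pi → A ⊆ P → ∃ V, IsOpen V ∧ ∀ x ∈ N, x ∈ A ↔ x ∈ V := by
    intro A ℓ hA hℓ hAP
    rcases A.eq_empty_or_nonempty with rfl | hne
    · exact ⟨∅, isOpen_empty, fun _ _ => Iff.rfl⟩
    · obtain ⟨u, v, huv, -⟩ := hA.exists_halfSpaces hℓ hne hP hAP
      refine ⟨{x | 0 < ⟪u, x⟫} ∩ {x | 0 < ⟪v, x⟫}, ?_, fun x hx => huv x (hNP hx)⟩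
      exact (isOpen_lt continuous_const (by fun_prop)).inter
        (isOpen_lt continuous_const (by fun_prop))
  obtain ⟨V₁, ho₁, hV₁⟩ := hopen hA₁ hℓ₁ h₁
  obtain ⟨V₂, ho₂, hV₂⟩ := hopen hA₂ hℓ₂ h₂
  by_contra! hcon
  obtain ⟨⟨x, hxN, hx⟩, ⟨y, hyN, hy⟩⟩ := And.imp Set.not_subset.1 Set.not_subset.1 hcon
  obtain ⟨z, hz, hz₁, hz₂⟩ := hN V₁ V₂ ho₁ ho₂
    (fun z hz => (hcov hz).imp (hV₁ z hz).1 (hV₂ z hz).1)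
    ⟨y, hyN, (hV₁ y hyN).1 ((hcov hyN).resolve_right hy)⟩
    ⟨x, hxN, (hV₂ x hxN).1 ((hcov hxN).resolve_left hx)⟩
  exact Set.disjoint_left.1 hdisj ((hV₁ z hz).2 hz₁) ((hV₂ z hz).2 hz₂)

/-- If the boundaries `K₁ = closure I₁ \ I₁`, `K₂ = closure I₂ \ I₂` of two nonempty open
spherically convex subsets `I₁, I₂` of the unit sphere are in good position, then `I₁ ∪ I₂`
contains a pair of antipodal points, one in each of `I₁`, `I₂`. -/
theorem stmt_2 (n : ℕ) (hn : 1 ≤ n)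
    (I₁ I₂ : Set (EuclideanSpace ℝ (Fin (n + 1))))
    (hne₁ : I₁.Nonempty) (hne₂ : I₂.Nonempty)
    -- `I₁`, `I₂` are open subsets of the sphere
    (hopen₁ : ∃ U : Set (EuclideanSpace ℝ (Fin (n + 1))),
      IsOpen U ∧ I₁ = U ∩ Metric.sphere 0 1)
    (hopen₂ : ∃ U : Set (EuclideanSpace ℝ (Fin (n + 1))),
      IsOpen U ∧ I₂ = U ∩ Metric.sphere 0 1)
    -- the cones over `I₁`, `I₂` are convex and contain no antipodal pair of directions
    (hconv₁ : Convex ℝ (radialCone I₁)) (hconv₂ : Convex ℝ (radialCone I₂))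
    (hproper₁ : ¬ ∃ y : EuclideanSpace ℝ (Fin (n + 1)),
      y ≠ 0 ∧ y ∈ radialCone I₁ ∧ -y ∈ radialCone I₁)
    (hproper₂ : ¬ ∃ y : EuclideanSpace ℝ (Fin (n + 1)),
      y ≠ 0 ∧ y ∈ radialCone I₂ ∧ -y ∈ radialCone I₂)
    -- good position, condition (1): disjoint closures
    (hdisj : closure I₁ ∩ closure I₂ = ∅)
    -- good position, condition (2): every great circle meeting both boundaries cuts the
    -- complement into two disjoint open arcs of length `< π`
    (hgood : ∀ P : Submodule ℝ (EuclideanSpace ℝ (Fin (n + 1))), Module.finrank ℝ P = 2 →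
      ((P : Set (EuclideanSpace ℝ (Fin (n + 1)))) ∩ Metric.sphere 0 1 ∩
        (closure I₁ \ I₁)).Nonempty →
      ((P : Set (EuclideanSpace ℝ (Fin (n + 1)))) ∩ Metric.sphere 0 1 ∩
        (closure I₂ \ I₂)).Nonempty →
      ∃ A₁ A₂ : Set (EuclideanSpace ℝ (Fin (n + 1))), ∃ ℓ₁ ℓ₂ : ℝ,
        ℓ₁ < Real.pi ∧ ℓ₂ < Real.pi ∧ IsOpenArc A₁ ℓ₁ ∧ IsOpenArc A₂ ℓ₂ ∧
        Disjoint A₁ A₂ ∧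
        ((P : Set (EuclideanSpace ℝ (Fin (n + 1)))) ∩ Metric.sphere 0 1) \
          (closure I₁ ∪ closure I₂) = A₁ ∪ A₂) :
    ∃ x ∈ I₁, -x ∈ I₂ := by
  obtain ⟨U₁, hU₁, hI₁⟩ := hopen₁
  obtain ⟨U₂, hU₂, hI₂⟩ := hopen₂
  have hS₁ : I₁ ⊆ Metric.sphere 0 1 := hI₁ ▸ Set.inter_subset_right
  have hS₂ : I₂ ⊆ Metric.sphere 0 1 := hI₂ ▸ Set.inter_subset_right
  by_contra! hcon
  have hcones : Disjoint (radialCone I₁) (-radialCone I₂) := by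
    rw [Set.disjoint_left]
    intro y hy₁ hy₂
    rw [Set.mem_neg, mem_radialCone_iff hS₂] at hy₂
    rw [mem_radialCone_iff hS₁] at hy₁
    refine hcon _ hy₁.2 ?_
    simpa using hy₂.2
  obtain ⟨f, hf₁, hf₂⟩ := exists_common_halfSpace hne₁ hne₂ (isOpen_radialCone hU₁ hI₁)
    (isOpen_radialCone hU₂ hI₂) hconv₁ hconv₂ hcones
  have hfc : ∀ I : Set (EuclideanSpace ℝ (Fin (n + 1))), (∀ x ∈ I, 0 < f x) →
      ∀ x ∈ closure I, 0 ≤ f x := fun I hI =>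
    closure_minimal (fun x hx => (hI x hx).le) (isClosed_le continuous_const f.continuous)
  have hH : IsPreconnected ({x | 0 < f x} ∩ Metric.sphere 0 1) := by
    refine isPreconnected_inter_sphere (convex_halfSpace_gt f.isLinear 0) (by simp) ?_
    intro r hr x hx
    simpa using mul_pos hr hx
  obtain ⟨p, hp⟩ := hne₁
  obtain ⟨q, hq⟩ := hne₂
  have hd := Set.disjoint_left.1 (Set.disjoint_iff_inter_eq_empty.2 hdisj)
  obtain ⟨k₁, ⟨hfk₁, hk₁S⟩, hk₁⟩ := exists_mem_closure_diff hH Set.inter_subset_right hU₁ hI₁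
    ⟨p, ⟨hf₁ p hp, hS₁ hp⟩, hp⟩
    ⟨q, ⟨hf₂ q hq, hS₂ hq⟩, fun h => hd h (subset_closure hq)⟩
  obtain ⟨k₂, ⟨hfk₂, hk₂S⟩, hk₂⟩ := exists_mem_closure_diff hH Set.inter_subset_right hU₂ hI₂
    ⟨q, ⟨hf₂ q hq, hS₂ hq⟩, hq⟩
    ⟨p, ⟨hf₁ p hp, hS₁ hp⟩, hd (subset_closure hp)⟩
  rw [Set.mem_ofPred_eq] at hfk₁ hfk₂
  have hw0 : f k₂ • k₁ - f k₁ • k₂ ≠ 0 := by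
    intro h
    rw [sub_eq_zero] at h
    have hn := congrArg norm h
    rw [norm_smul, norm_smul, mem_sphere_zero_iff_norm.1 hk₁S, mem_sphere_zero_iff_norm.1 hk₂S,
      Real.norm_of_nonneg hfk₁.le, Real.norm_of_nonneg hfk₂.le, mul_one, mul_one] at hn
    rw [hn] at h
    exact hd hk₁.1 (smul_right_injective _ hfk₁.ne' h ▸ hk₂.1)
  have hli : LinearIndependent ℝ ![k₁, k₂] := by
    rw [LinearIndependent.pair_iff]
    intro s t hst
    have hfst : s * f k₁ + t * f k₂ = 0 := by simpa using congrArg f hst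
    have hs : s • (f k₂ • k₁ - f k₁ • k₂) = 0 := by
      have e : s • (f k₂ • k₁ - f k₁ • k₂) =
          f k₂ • (s • k₁ + t • k₂) - (s * f k₁ + t * f k₂) • k₂ := by module
      rw [e, hst, hfst, smul_zero, zero_smul, sub_zero]
    have hs0 := (smul_eq_zero.1 hs).resolve_right hw0
    rw [hs0, zero_mul, zero_add] at hfst
    exact ⟨hs0, (mul_eq_zero.1 hfst).resolve_right hfk₂.ne'⟩
  set P := Submodule.span ℝ {k₁, k₂} with hPdef
  have hP : Module.finrank ℝ P = 2 := by
    have := finrank_span_eq_card hli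
    rw [Matrix.range_cons_cons_empty] at this
    simpa using this
  have hk₁P : k₁ ∈ P := Submodule.subset_span (by simp)
  have hk₂P : k₂ ∈ P := Submodule.subset_span (by simp)
  obtain ⟨A₁, A₂, ℓ₁, ℓ₂, hℓ₁, hℓ₂, hA₁, hA₂, hAd, hAU⟩ :=
    hgood P hP ⟨k₁, ⟨hk₁P, hk₁S⟩, hk₁⟩ ⟨k₂, ⟨hk₂P, hk₂S⟩, hk₂⟩
  have hAP : A₁ ∪ A₂ ⊆ (P : Set _) := hAU ▸ fun x hx => hx.1.1
  have h₁ := Set.subset_union_left.trans hAP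
  have h₂ := Set.subset_union_right.trans hAP
  have hN : IsPreconnected (((P : Set _) ∩ {x | f x < 0}) ∩ Metric.sphere 0 1) := by
    refine isPreconnected_inter_sphere
      (P.convex.inter (convex_halfSpace_lt f.isLinear 0)) (by simp) ?_
    rintro r hr x ⟨hxP, hx⟩
    exact ⟨P.smul_mem r hxP, by simpa using mul_neg_of_pos_of_neg hr hx⟩
  have hcov : ((P : Set _) ∩ {x | f x < 0}) ∩ Metric.sphere 0 1 ⊆ A₁ ∪ A₂ := by
    rw [← hAU]
    rintro x ⟨⟨hxP, hx⟩, hxS⟩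
    refine ⟨⟨hxP, hxS⟩, ?_⟩
    rintro (hc | hc)
    · exact (hfc I₁ hf₁ x hc).not_gt hx
    · exact (hfc I₂ hf₂ x hc).not_gt hx
  have hfk : f (-k₁) < 0 := by simpa using hfk₁
  have hwP : f k₂ • k₁ - f k₁ • k₂ ∈ P :=
    P.sub_mem (P.smul_mem _ hk₁P) (P.smul_mem _ hk₂P)
  have hfw : f (f k₂ • k₁ - f k₁ • k₂) = 0 := by
    simp only [map_sub, map_smul, smul_eq_mul]
    ring
  rcases hA₁.subset_or_subset hA₂ hℓ₁ hℓ₂ hAd hP h₁ h₂ hN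
    (fun x hx => ⟨hx.1.1, hx.2⟩) hcov with h | h
  · exact hA₁.not_halfCircle_subset hℓ₁ hP h₁ f (P.neg_mem hk₁P) hfk hwP hw0 hfw h
  · exact hA₂.not_halfCircle_subset hℓ₂ hP h₂ f (P.neg_mem hk₁P) hfk hwP hw0 hfw h
end

section
/- Let p, q ∈ Q with p₁ ≤ q₁, p₂ ≤ q₂ and p ≠ q. Then there exists a unique point a in (ℝ_{≥0}×{0}) ∪ ({0}×ℝ_{≥0}) (the boundary of the closed first quadrant) lying on the affine line through p and q. Moreover p lies strictly between a and q on this line, and ‖q−a‖/‖p−a‖ = max(q₁/p₁, q₂/p₂); in particular the Hilbert distance (1/2)·log(‖q−a‖/‖p−a‖) equals (1/2)·max(log(q₁/p₁), log(q₂/p₂)). -/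
/-- If `p > 0`, `d ≥ 0` and the point `p - c • d` of the plane has nonnegative coordinates, one of
which vanishes, then it is the only such point on the line `p + s • d`. -/
lemma eq_neg_of_boundary {p₀ p₁ d₀ d₁ c s : ℝ} (hp₀ : 0 < p₀) (hp₁ : 0 < p₁)
    (hd₀ : 0 ≤ d₀) (hd₁ : 0 ≤ d₁) (h₀ : c * d₀ ≤ p₀) (h₁ : c * d₁ ≤ p₁)
    (h : c * d₀ = p₀ ∨ c * d₁ = p₁)
    (hs : (0 ≤ p₀ + s * d₀ ∧ p₁ + s * d₁ = 0) ∨ (p₀ + s * d₀ = 0 ∧ 0 ≤ p₁ + s * d₁)) :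
    s = -c := by
  have n₀ : 0 ≤ p₀ + s * d₀ := by rcases hs with h | h <;> linarith [h.1]
  have n₁ : 0 ≤ p₁ + s * d₁ := by rcases hs with h | h <;> linarith [h.2]
  apply le_antisymm
  · by_contra! hlt
    rcases hs with ⟨-, e⟩ | ⟨e, -⟩
    · have : 0 < d₁ := hd₁.lt_of_ne (by rintro rfl; simp at e; linarith)
      nlinarith [mul_pos (sub_pos.2 hlt) this]
    · have : 0 < d₀ := hd₀.lt_of_ne (by rintro rfl; simp at e; linarith)
      nlinarith [mul_pos (sub_pos.2 hlt) this]
  · by_contra! hlt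
    rcases h with e | e
    · have : 0 < d₀ := hd₀.lt_of_ne (by rintro rfl; simp at e; linarith)
      nlinarith [mul_pos (sub_pos.2 hlt) this]
    · have : 0 < d₁ := hd₁.lt_of_ne (by rintro rfl; simp at e; linarith)
      nlinarith [mul_pos (sub_pos.2 hlt) this]


/-- For `p ≤ q` (componentwise, `p ≠ q`) in the open positive quadrant, the line through
`p` and `q` meets the boundary of the closed first quadrant in a unique point `a`; the
point `p` lies strictly between `a` and `q`, and the degenerate Hilbert distance
`(1/2) log (‖q - a‖ / ‖p - a‖)` equals `(1/2) max (log (q₁/p₁)) (log (q₂/p₂))`. -/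
theorem stmt_3 (p q : EuclideanSpace ℝ (Fin 2))
    (hp1 : 0 < p 0) (hp2 : 0 < p 1) (hq1 : 0 < q 0) (hq2 : 0 < q 1)
    (hle1 : p 0 ≤ q 0) (hle2 : p 1 ≤ q 1) (hne : p ≠ q) :
    ∃ a : EuclideanSpace ℝ (Fin 2),
      ((0 ≤ a 0 ∧ a 1 = 0) ∨ (a 0 = 0 ∧ 0 ≤ a 1)) ∧
      a ∈ affineSpan ℝ ({p, q} : Set (EuclideanSpace ℝ (Fin 2))) ∧
      (∀ a' : EuclideanSpace ℝ (Fin 2),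
        ((0 ≤ a' 0 ∧ a' 1 = 0) ∨ (a' 0 = 0 ∧ 0 ≤ a' 1)) →
        a' ∈ affineSpan ℝ ({p, q} : Set (EuclideanSpace ℝ (Fin 2))) → a' = a) ∧
      Sbtw ℝ a p q ∧
      ‖q - a‖ / ‖p - a‖ = max (q 0 / p 0) (q 1 / p 1) ∧
      (1 / 2) * Real.log (‖q - a‖ / ‖p - a‖)
        = (1 / 2) * max (Real.log (q 0 / p 0)) (Real.log (q 1 / p 1)) := by
  have hlog : Real.log (max (q 0 / p 0) (q 1 / p 1))
      = max (Real.log (q 0 / p 0)) (Real.log (q 1 / p 1)) :=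
    Real.strictMonoOn_log.monotoneOn.map_max (div_pos hq1 hp1) (div_pos hq2 hp2)
  have hM0 : q 0 ≤ max (q 0 / p 0) (q 1 / p 1) * p 0 := (div_le_iff₀ hp1).1 (le_max_left _ _)
  have hM1 : q 1 ≤ max (q 0 / p 0) (q 1 / p 1) * p 1 := (div_le_iff₀ hp2).1 (le_max_right _ _)
  have hM : q 0 = max (q 0 / p 0) (q 1 / p 1) * p 0 ∨
      q 1 = max (q 0 / p 0) (q 1 / p 1) * p 1 := by
    rcases max_choice (q 0 / p 0) (q 1 / p 1) with h | h <;> rw [h]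
    · left; field_simp
    · right; field_simp
  have hlt : 1 < max (q 0 / p 0) (q 1 / p 1) := by
    rw [lt_max_iff, one_lt_div hp1, one_lt_div hp2]
    by_contra! h
    apply hne
    ext i
    fin_cases i
    · exact le_antisymm hle1 h.1
    · exact le_antisymm hle2 h.2
  rw [← hlog]
  generalize max (q 0 / p 0) (q 1 / p 1) = M at *
  obtain ⟨c, hc, hcM⟩ : ∃ c : ℝ, 0 < c ∧ c * (M - 1) = 1 :=
    ⟨(M - 1)⁻¹, inv_pos.2 (sub_pos.2 hlt), inv_mul_cancel₀ (sub_pos.2 hlt).ne'⟩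
  have e0 : c * (M * p 0 - p 0) = p 0 := by linear_combination p 0 * hcM
  have e1 : c * (M * p 1 - p 1) = p 1 := by linear_combination p 1 * hcM
  have h0 : c * (q 0 - p 0) ≤ p 0 :=
    (mul_le_mul_of_nonneg_left (by linarith) hc.le).trans e0.le
  have h1 : c * (q 1 - p 1) ≤ p 1 :=
    (mul_le_mul_of_nonneg_left (by linarith) hc.le).trans e1.le
  have h : c * (q 0 - p 0) = p 0 ∨ c * (q 1 - p 1) = p 1 :=
    hM.imp (fun h => by rw [h, e0]) (fun h => by rw [h, e1])
  have hpa : p - AffineMap.lineMap p q (-c) = c • (q - p) := by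
    simp [AffineMap.lineMap_apply]
  have hqa : q - AffineMap.lineMap p q (-c) = M • c • (q - p) := by
    rw [smul_smul, show M * c = 1 + c by linear_combination hcM, AffineMap.lineMap_apply,
      vsub_eq_sub, vadd_eq_add]
    module
  have hqp : q - p ≠ 0 := sub_ne_zero.2 hne.symm
  have hratio : ‖q - AffineMap.lineMap p q (-c)‖ / ‖p - AffineMap.lineMap p q (-c)‖ = M := by
    rw [hpa, hqa, norm_smul M, Real.norm_of_nonneg (by linarith),
      mul_div_cancel_right₀ _ (norm_ne_zero_iff.2 (smul_ne_zero hc.ne' hqp))]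
  refine ⟨AffineMap.lineMap p q (-c), ?_, AffineMap.lineMap_mem_affineSpan_pair _ _ _, ?_, ?_,
    hratio, by rw [hratio]⟩
  · simp only [AffineMap.lineMap_apply, vsub_eq_sub, vadd_eq_add, PiLp.add_apply,
      PiLp.smul_apply, PiLp.sub_apply, smul_eq_mul]
    rcases h with h | h
    · right; constructor <;> linarith
    · left; constructor <;> linarith
  · intro a' ha' hmem
    obtain ⟨s, rfl⟩ := mem_affineSpan_pair_iff_exists_lineMap_eq.1 hmem
    simp only [AffineMap.lineMap_apply, vsub_eq_sub, vadd_eq_add, PiLp.add_apply,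
      PiLp.smul_apply, PiLp.sub_apply, smul_eq_mul] at ha'
    rw [eq_neg_of_boundary (s := s) hp1 hp2 (sub_nonneg.2 hle1) (sub_nonneg.2 hle2) h0 h1 h
      (by simpa only [add_comm] using ha')]
  · refine ⟨⟨M⁻¹, ⟨by positivity, inv_le_one_of_one_le₀ hlt.le⟩, ?_⟩, ?_, hne⟩
    · rw [AffineMap.lineMap_apply _ q, vsub_eq_sub, vadd_eq_add, hqa,
        inv_smul_smul₀ (by linarith), ← hpa, sub_add_cancel]
    · rw [← sub_ne_zero, hpa]
      exact smul_ne_zero hc.ne' hqp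
end

section
/- Let p, q ∈ Q with p₁ < q₁ and q₂ < p₂ (so the line through p and q has negative slope). Let a = (0, a₂) and b = (b₁, 0) be the intersection points of the affine line through p and q with the two coordinate axes. Then a₂ > 0, b₁ > 0, the points a, p, q, b occur in that order on the line, and the Euclidean cross ratio satisfies (‖p−b‖·‖q−a‖)/(‖q−b‖·‖p−a‖) = (q₁·p₂)/(p₁·q₂). Consequently the Hilbert distance (1/2)·log((‖p−b‖·‖q−a‖)/(‖q−b‖·‖p−a‖)) equals (1/2)·(log(q₁/p₁) + log(p₂/q₂)), which equals (1/2)·max{|log(p₁/q₁)|, |log(p₂/q₂)|, |log((p₁·q₂)/(q₁·p₂))|}. -/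
theorem sbtw_lineMap_of_neg {V : Type*} [AddCommGroup V] [Module ℝ V] {p q : V}
    (hpq : p ≠ q) {r : ℝ} (hr : r < 0) : Sbtw ℝ (AffineMap.lineMap p q r) p q := by
  have hr1 : 1 - r ≠ 0 := by linarith
  have key : AffineMap.lineMap (AffineMap.lineMap p q r) q (-r / (1 - r)) = p := by
    simp only [AffineMap.lineMap_apply_module]
    match_scalars <;> field_simp <;> ring
  have hne : AffineMap.lineMap p q r ≠ q := fun h =>
    (hr.trans one_pos).ne ((AffineMap.lineMap_eq_right_iff.mp h).resolve_left hpq)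
  have := (sbtw_lineMap_iff (R := ℝ) (x := AffineMap.lineMap p q r) (y := q)
    (r := -r / (1 - r))).mpr
    ⟨hne, div_pos (by linarith) (by linarith), (div_lt_one (by linarith)).mpr (by linarith)⟩
  rwa [key] at this

theorem norm_cross_ratio_lineMap {V : Type*} [NormedAddCommGroup V] [NormedSpace ℝ V] {p q : V}
    (hpq : p ≠ q) (r s : ℝ) :
    (‖p - AffineMap.lineMap p q s‖ * ‖q - AffineMap.lineMap p q r‖) /
      (‖q - AffineMap.lineMap p q s‖ * ‖p - AffineMap.lineMap p q r‖) =
      (|s| * |1 - r|) / (|1 - s| * |r|) := by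
  have hd : dist p q ≠ 0 := dist_ne_zero.mpr hpq
  simp only [← dist_eq_norm, dist_left_lineMap, dist_right_lineMap, Real.norm_eq_abs]
  rw [Real.dist_eq, Real.dist_eq, mul_mul_mul_comm, mul_mul_mul_comm |1 - s|,
    mul_div_mul_right _ _ (mul_ne_zero hd hd)]

theorem add_eq_max_abs_neg {x y : ℝ} (hx : 0 ≤ x) (hy : 0 ≤ y) :
    x + y = max (max |-x| |y|) |-(x + y)| := by
  rw [abs_neg, abs_neg, abs_of_nonneg hx, abs_of_nonneg hy, abs_of_nonneg (add_nonneg hx hy),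
    max_eq_right (max_le (le_add_of_nonneg_right hy) (le_add_of_nonneg_left hx))]

/-- For `p`, `q` in the open positive quadrant with `p₁ < q₁` and `q₂ < p₂` (negative
slope), the intersection points `a = (0, a₂)`, `b = (b₁, 0)` of the line `pq` with the
coordinate axes satisfy `a₂ > 0`, `b₁ > 0`, lie in the order `a, p, q, b`, the cross ratio
equals `(q₁ p₂)/(p₁ q₂)`, and the Hilbert distance equals Phadke's formula. -/
theorem stmt_4 (p q a b : EuclideanSpace ℝ (Fin 2))
    (hp1 : 0 < p 0) (hp2 : 0 < p 1) (hq1 : 0 < q 0) (hq2 : 0 < q 1)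
    (h1 : p 0 < q 0) (h2 : q 1 < p 1)
    (ha0 : a 0 = 0) (hb1 : b 1 = 0)
    (ha : a ∈ affineSpan ℝ ({p, q} : Set (EuclideanSpace ℝ (Fin 2))))
    (hb : b ∈ affineSpan ℝ ({p, q} : Set (EuclideanSpace ℝ (Fin 2)))) :
    0 < a 1 ∧ 0 < b 0 ∧ Sbtw ℝ a p q ∧ Sbtw ℝ p q b ∧
    (‖p - b‖ * ‖q - a‖) / (‖q - b‖ * ‖p - a‖) = (q 0 * p 1) / (p 0 * q 1) ∧
    (1 / 2) * Real.log ((‖p - b‖ * ‖q - a‖) / (‖q - b‖ * ‖p - a‖))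
      = (1 / 2) * (Real.log (q 0 / p 0) + Real.log (p 1 / q 1)) ∧
    (1 / 2) * (Real.log (q 0 / p 0) + Real.log (p 1 / q 1))
      = (1 / 2) * max (max |Real.log (p 0 / q 0)| |Real.log (p 1 / q 1)|)
          |Real.log ((p 0 * q 1) / (q 0 * p 1))| := by
  have hpq : p ≠ q := fun h => h1.ne (congrArg (fun v => v 0) h)
  obtain ⟨r, rfl⟩ := mem_affineSpan_pair_iff_exists_lineMap_eq.mp ha
  obtain ⟨s, rfl⟩ := mem_affineSpan_pair_iff_exists_lineMap_eq.mp hb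
  have hcoord (t : ℝ) (i : Fin 2) :
      (AffineMap.lineMap p q t : EuclideanSpace ℝ (Fin 2)) i = p i + t * (q i - p i) := by
    simp [AffineMap.lineMap_apply, add_comm]
  have hd0 : 0 < q 0 - p 0 := sub_pos.mpr h1
  have hd1 : 0 < p 1 - q 1 := sub_pos.mpr h2
  rw [hcoord] at ha0 hb1
  have hr : r = -p 0 / (q 0 - p 0) := by
    rw [eq_div_iff hd0.ne']; linarith
  have hs : s = p 1 / (p 1 - q 1) := by
    rw [eq_div_iff hd1.ne']; linarith
  have hr0 : r < 0 := hr ▸ div_neg_of_neg_of_pos (neg_neg_of_pos hp1) hd0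
  have hs1 : 1 < s := by
    rw [hs, one_lt_div hd1]; linarith
  have hratio : (|s| * |1 - r|) / (|1 - s| * |r|) = (q 0 * p 1) / (p 0 * q 1) := by
    rw [abs_of_pos (one_pos.trans hs1), abs_of_pos (by linarith : 0 < 1 - r),
      abs_of_neg (by linarith : 1 - s < 0), abs_of_neg hr0]
    have hr' : 1 - r = q 0 / (q 0 - p 0) := by rw [hr]; field_simp; ring
    have hs' : -(1 - s) = q 1 / (p 1 - q 1) := by rw [hs]; field_simp; ring
    rw [hr', hs', hr, hs]
    field_simp
  have hlog : Real.log ((q 0 * p 1) / (p 0 * q 1)) =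
      Real.log (q 0 / p 0) + Real.log (p 1 / q 1) := by
    rw [mul_div_mul_comm, Real.log_mul (by positivity) (by positivity)]
  rw [norm_cross_ratio_lineMap hpq, hratio, hlog, hcoord, hcoord]
  refine ⟨?_, ?_, sbtw_lineMap_of_neg hpq hr0, ?_, rfl, rfl, ?_⟩
  · nlinarith
  · nlinarith
  · rw [← AffineMap.lineMap_apply_one_sub, sbtw_comm]
    exact sbtw_lineMap_of_neg hpq.symm (by linarith)
  · rw [← inv_div (q 0) (p 0), ← inv_div (q 0 * p 1) (p 0 * q 1), Real.log_inv, Real.log_inv,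
      hlog, ← add_eq_max_abs_neg (Real.log_nonneg ((one_le_div hp1).mpr h1.le))
        (Real.log_nonneg ((one_le_div hq2).mpr h2.le))]
end

section
/- Define N : ℝ² → ℝ by N(v) = (1/2)·max{|v₁|, |v₂|, |v₁−v₂|}, and define H : Q × Q → ℝ by H(p,q) = (1/2)·max{|log(p₁/q₁)|, |log(p₂/q₂)|, |log((p₁·q₂)/(q₁·p₂))|}. Then: (i) N is a norm on ℝ²; (ii) the map Log : Q → ℝ², (x₁,x₂) ↦ (log x₁, log x₂), is a bijection satisfying H(p,q) = N(Log p − Log q) for all p, q ∈ Q; (iii) consequently H is a metric on Q and (Q, H) is isometric to the two-dimensional normed space (ℝ², N); (iv) for all λ₁, λ₂ > 0, H((λ₁p₁, λ₂p₂), (λ₁q₁, λ₂q₂)) = H(p,q), so the group (ℝ_{>0})² acts on (Q, H) by isometries. -/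
/-- The open positive quadrant of the plane. -/
def Q : Set (ℝ × ℝ) := {x | 0 < x.1 ∧ 0 < x.2}

/-- The norm `N(v) = (1/2) max {|v₁|, |v₂|, |v₁ - v₂|}` on `ℝ²`. -/
noncomputable def N (v : ℝ × ℝ) : ℝ := (1 / 2) * max (max |v.1| |v.2|) |v.1 - v.2|

/-- Phadke's formula for the Hilbert metric of the quadrant. -/
noncomputable def Hdist (p q : ℝ × ℝ) : ℝ :=
  (1 / 2) * max (max |Real.log (p.1 / q.1)| |Real.log (p.2 / q.2)|)
    |Real.log ((p.1 * q.2) / (q.1 * p.2))|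

/-- Coordinatewise logarithm. -/
noncomputable def LogMap (x : ℝ × ℝ) : ℝ × ℝ := (Real.log x.1, Real.log x.2)

theorem N_nonneg (v : ℝ × ℝ) : 0 ≤ N v := by
  unfold N
  positivity

theorem N_eq_zero_iff (v : ℝ × ℝ) : N v = 0 ↔ v = 0 := by
  refine ⟨fun h => ?_, fun h => by simp [h, N]⟩
  have hmax : max (max |v.1| |v.2|) |v.1 - v.2| = 0 := by
    unfold N at h
    linarith
  have hle := hmax.le
  simp only [max_le_iff, abs_nonpos_iff] at hle
  exact Prod.ext hle.1.1 hle.1.2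

theorem N_smul (c : ℝ) (v : ℝ × ℝ) : N (c • v) = |c| * N v := by
  simp only [N, Prod.smul_fst, Prod.smul_snd, smul_eq_mul, ← mul_sub, abs_mul,
    ← mul_max_of_nonneg _ _ (abs_nonneg c)]
  ring

theorem N_add_le (v w : ℝ × ℝ) : N (v + w) ≤ N v + N w := by
  have h : max (max |v.1 + w.1| |v.2 + w.2|) |v.1 + w.1 - (v.2 + w.2)| ≤
      max (max |v.1| |v.2|) |v.1 - v.2| + max (max |w.1| |w.2|) |w.1 - w.2| := by
    refine max_le (max_le ?_ ?_) ?_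
    · exact (abs_add_le _ _).trans (add_le_add (by simp) (by simp))
    · exact (abs_add_le _ _).trans (add_le_add (by simp) (by simp))
    · rw [add_sub_add_comm]
      exact (abs_add_le _ _).trans (add_le_add (by simp) (by simp))
  simp only [N, Prod.fst_add, Prod.snd_add]
  linarith

theorem N_neg (v : ℝ × ℝ) : N (-v) = N v := by
  simpa using N_smul (-1) v

theorem LogMap_bijOn : Set.BijOn LogMap Q Set.univ := by
  refine ⟨fun _ _ => Set.mem_univ _, fun p hp q hq h => ?_, fun y _ => ?_⟩
  · have h' := Prod.ext_iff.mp h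
    exact Prod.ext (Real.log_injOn_pos hp.1 hq.1 h'.1) (Real.log_injOn_pos hp.2 hq.2 h'.2)
  · exact ⟨(Real.exp y.1, Real.exp y.2), ⟨Real.exp_pos _, Real.exp_pos _⟩, by simp [LogMap]⟩

theorem Hdist_eq_N {p q : ℝ × ℝ} (hp : p ∈ Q) (hq : q ∈ Q) :
    Hdist p q = N (LogMap p - LogMap q) := by
  have hp₁ := hp.1.ne'
  have hp₂ := hp.2.ne'
  have hq₁ := hq.1.ne'
  have hq₂ := hq.2.ne'
  simp only [Hdist, N, LogMap, Prod.fst_sub, Prod.snd_sub]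
  rw [Real.log_div hp₁ hq₁, Real.log_div hp₂ hq₂,
    Real.log_div (mul_ne_zero hp₁ hq₂) (mul_ne_zero hq₁ hp₂),
    Real.log_mul hp₁ hq₂, Real.log_mul hq₁ hp₂]
  congr 3
  ring

theorem Hdist_mul_mul {l₁ l₂ : ℝ} (h₁ : l₁ ≠ 0) (h₂ : l₂ ≠ 0) (p q : ℝ × ℝ) :
    Hdist (l₁ * p.1, l₂ * p.2) (l₁ * q.1, l₂ * q.2) = Hdist p q := by
  simp only [Hdist]
  rw [mul_div_mul_left _ _ h₁, mul_div_mul_left _ _ h₂, mul_mul_mul_comm l₁ p.1,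
    mul_mul_mul_comm l₁ q.1, mul_div_mul_left _ _ (mul_ne_zero h₁ h₂)]

/-- Busemann's theorem for the 2-simplex: (i) `N` is a norm on `ℝ²`; (ii) `Log` is a
bijection from the quadrant to `ℝ²` carrying the Hilbert metric `H` to `N`; (iii) `H` is a
metric on the quadrant; (iv) `(ℝ_{>0})²` acts on `(Q, H)` by isometries. -/
theorem stmt_5 :
    -- (i) `N` is a norm on `ℝ²`
    ((∀ v : ℝ × ℝ, 0 ≤ N v) ∧ (∀ v : ℝ × ℝ, N v = 0 ↔ v = 0) ∧
      (∀ (c : ℝ) (v : ℝ × ℝ), N (c • v) = |c| * N v) ∧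
      (∀ v w : ℝ × ℝ, N (v + w) ≤ N v + N w)) ∧
    -- (ii) `Log` is a bijection from `Q` onto `ℝ²` with `H p q = N (Log p - Log q)`
    (Set.BijOn LogMap Q Set.univ ∧
      ∀ p ∈ Q, ∀ q ∈ Q, Hdist p q = N (LogMap p - LogMap q)) ∧
    -- (iii) `H` is a metric on `Q`
    ((∀ p ∈ Q, ∀ q ∈ Q, (Hdist p q = 0 ↔ p = q)) ∧
      (∀ p ∈ Q, ∀ q ∈ Q, Hdist p q = Hdist q p) ∧
      (∀ p ∈ Q, ∀ q ∈ Q, ∀ r ∈ Q, Hdist p r ≤ Hdist p q + Hdist q r)) ∧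
    -- (iv) the `(ℝ_{>0})²`-action is by isometries
    (∀ l₁ l₂ : ℝ, 0 < l₁ → 0 < l₂ → ∀ p ∈ Q, ∀ q ∈ Q,
      Hdist (l₁ * p.1, l₂ * p.2) (l₁ * q.1, l₂ * q.2) = Hdist p q) := by
  refine ⟨⟨N_nonneg, N_eq_zero_iff, N_smul, N_add_le⟩,
    ⟨LogMap_bijOn, fun p hp q hq => Hdist_eq_N hp hq⟩,
    ⟨fun p hp q hq => ?_, fun p hp q hq => ?_, fun p hp q hq r hr => ?_⟩,
    fun l₁ l₂ h₁ h₂ p _ q _ => Hdist_mul_mul h₁.ne' h₂.ne' p q⟩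
  · rw [Hdist_eq_N hp hq, N_eq_zero_iff, sub_eq_zero, LogMap_bijOn.injOn.eq_iff hp hq]
  · rw [Hdist_eq_N hp hq, Hdist_eq_N hq hp, ← N_neg, neg_sub]
  · rw [Hdist_eq_N hp hr, Hdist_eq_N hp hq, Hdist_eq_N hq hr,
      ← sub_add_sub_cancel (LogMap p) (LogMap q)]
    exact N_add_le _ _
end

section
/- Let p, q ∈ Q with p₁ < q₁ and p₂ < q₂. Then there exists a unique point a in (ℝ_{≤0}×{0}) ∪ ({0}×ℝ_{≤0}) (the boundary of the closed third quadrant) lying on the affine line through p and q. Moreover p lies strictly between a and q on this line, and ‖q−a‖/‖p−a‖ = min(q₁/p₁, q₂/p₂); in particular the timelike Hilbert distance (1/2)·log(‖q−a‖/‖p−a‖) equals (1/2)·min(log(q₁/p₁), log(q₂/p₂)). -/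
/-- A parameter `t` at which the line `x + t (y - x)` meets the boundary of the closed third
quadrant is determined by the smallest coordinate ratio `m`. -/
lemma param_mul_eq_neg_one {x₀ x₁ y₀ y₁ m t : ℝ} (hx₀ : 0 < x₀) (hx₁ : 0 < x₁)
    (h₀ : x₀ < y₀) (h₁ : x₁ < y₁) (hm₀ : m * x₀ ≤ y₀) (hm₁ : m * x₁ ≤ y₁)
    (hm : m * x₀ = y₀ ∨ m * x₁ = y₁)
    (ht₀ : x₀ + t * (y₀ - x₀) ≤ 0) (ht₁ : x₁ + t * (y₁ - x₁) = 0) :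
    t * (m - 1) = -1 := by
  have ht : t < 0 := by
    by_contra! h
    nlinarith [mul_nonneg h (sub_pos.2 h₁).le]
  rcases hm with rfl | rfl
  · apply le_antisymm
    · have : x₀ * (t * (m - 1) + 1) ≤ 0 := by linarith
      linarith [nonpos_of_mul_nonpos_right this hx₀]
    · have : 0 ≤ x₁ * (t * (m - 1) + 1) := by nlinarith
      linarith [nonneg_of_mul_nonneg_right this hx₁]
  · have : x₁ * (t * (m - 1) + 1) = 0 := by linarith
    rcases mul_eq_zero.1 this with h | h <;> linarith

/-- For `p < q` (componentwise) in the open positive quadrant, the line through `p` and `q`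
meets the boundary of the closed third quadrant in a unique point `a`; the point `p` lies
strictly between `a` and `q`, and the timelike Hilbert distance
`(1/2) log (‖q - a‖ / ‖p - a‖)` equals `(1/2) min (log (q₁/p₁)) (log (q₂/p₂))`. -/
theorem stmt_6 (p q : EuclideanSpace ℝ (Fin 2))
    (hp1 : 0 < p 0) (hp2 : 0 < p 1) (hq1 : 0 < q 0) (hq2 : 0 < q 1)
    (hlt1 : p 0 < q 0) (hlt2 : p 1 < q 1) :
    ∃ a : EuclideanSpace ℝ (Fin 2),
      ((a 0 ≤ 0 ∧ a 1 = 0) ∨ (a 0 = 0 ∧ a 1 ≤ 0)) ∧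
      a ∈ affineSpan ℝ ({p, q} : Set (EuclideanSpace ℝ (Fin 2))) ∧
      (∀ a' : EuclideanSpace ℝ (Fin 2),
        ((a' 0 ≤ 0 ∧ a' 1 = 0) ∨ (a' 0 = 0 ∧ a' 1 ≤ 0)) →
        a' ∈ affineSpan ℝ ({p, q} : Set (EuclideanSpace ℝ (Fin 2))) → a' = a) ∧
      Sbtw ℝ a p q ∧
      ‖q - a‖ / ‖p - a‖ = min (q 0 / p 0) (q 1 / p 1) ∧
      (1 / 2) * Real.log (‖q - a‖ / ‖p - a‖)
        = (1 / 2) * min (Real.log (q 0 / p 0)) (Real.log (q 1 / p 1)) := by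
  set m := min (q 0 / p 0) (q 1 / p 1) with hmdef
  have hm1 : 1 < m := lt_min ((one_lt_div hp1).2 hlt1) ((one_lt_div hp2).2 hlt2)
  have hm0 : m * p 0 ≤ q 0 := (le_div_iff₀ hp1).1 (min_le_left _ _)
  have hm1' : m * p 1 ≤ q 1 := (le_div_iff₀ hp2).1 (min_le_right _ _)
  have hm : m * p 0 = q 0 ∨ m * p 1 = q 1 := by
    rcases min_choice (q 0 / p 0) (q 1 / p 1) with h | h
    · exact Or.inl ((eq_div_iff hp1.ne').1 h)
    · exact Or.inr ((eq_div_iff hp2.ne').1 h)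
  have hmp : 0 < m - 1 := sub_pos.2 hm1
  have hpq : p ≠ q := fun h => by simp [h] at hlt1
  set a : EuclideanSpace ℝ (Fin 2) := AffineMap.lineMap p q (-(m - 1)⁻¹) with ha
  have hai (i : Fin 2) : a i = (m * p i - q i) / (m - 1) := by
    simp only [ha, AffineMap.lineMap_apply, vsub_eq_sub, vadd_eq_add, PiLp.add_apply,
      PiLp.smul_apply, PiLp.sub_apply, smul_eq_mul]
    field_simp
    ring
  have hpa : p - a = (m - 1)⁻¹ • (q - p) := by
    simp only [ha, AffineMap.lineMap_apply, vsub_eq_sub, vadd_eq_add]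
    module
  have hqa : q - a = m • (p - a) := by
    ext i
    simp only [PiLp.sub_apply, PiLp.smul_apply, smul_eq_mul, hai]
    field_simp
    ring
  have hpa_ne : p - a ≠ 0 := by
    rw [hpa]
    exact smul_ne_zero (inv_ne_zero hmp.ne') (sub_ne_zero.2 hpq.symm)
  have hratio : ‖q - a‖ / ‖p - a‖ = m := by
    rw [hqa, norm_smul, Real.norm_of_nonneg (by linarith),
      mul_div_cancel_right₀ _ (norm_ne_zero_iff.2 hpa_ne)]
  refine ⟨a, ?_, AffineMap.lineMap_mem_affineSpan_pair _ _ _, ?_, ⟨⟨m⁻¹, ?_, ?_⟩, ?_, hpq⟩,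
    hratio, ?_⟩
  · rw [hai, hai]
    rcases hm with h | h
    · exact Or.inr ⟨by simp [h], div_nonpos_of_nonpos_of_nonneg (by linarith) hmp.le⟩
    · exact Or.inl ⟨div_nonpos_of_nonpos_of_nonneg (by linarith) hmp.le, by simp [h]⟩
  · intro a' hb hmem
    obtain ⟨t, rfl⟩ := mem_affineSpan_pair_iff_exists_lineMap_eq.1 hmem
    have hti (i : Fin 2) : (AffineMap.lineMap p q t : EuclideanSpace ℝ (Fin 2)) i
        = p i + t * (q i - p i) := by
      simp [AffineMap.lineMap_apply, add_comm]
    rw [hti, hti] at hb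
    have ht : t * (m - 1) = -1 := by
      rcases hb with ⟨h0, h1⟩ | ⟨h0, h1⟩
      · exact param_mul_eq_neg_one hp1 hp2 hlt1 hlt2 hm0 hm1' hm h0 h1
      · exact param_mul_eq_neg_one hp2 hp1 hlt2 hlt1 hm1' hm0 hm.symm h1 h0
    rw [ha, eq_div_of_mul_eq hmp.ne' ht, neg_div, one_div]
  · exact ⟨by positivity, inv_le_one_of_one_le₀ hm1.le⟩
  · rw [AffineMap.lineMap_apply, vsub_eq_sub, vadd_eq_add, hqa, smul_smul,
      inv_mul_cancel₀ (by linarith), one_smul, sub_add_cancel]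
  · exact sub_ne_zero.1 hpa_ne
  · rw [hratio, hmdef]
    congr 1
    exact Real.strictMonoOn_log.monotoneOn.map_min (div_pos hq1 hp1) (div_pos hq2 hp2)
end

section
/- For p, q ∈ Q with p₁ ≤ q₁ and p₂ ≤ q₂ define T(p,q) = (1/2)·min(log(q₁/p₁), log(q₂/p₂)). Then T(p,p) = 0, T(p,q) ≥ 0 whenever it is defined, and T satisfies the time inequality (reverse triangle inequality): for all p, q, r ∈ Q with p₁ ≤ q₁ ≤ r₁ and p₂ ≤ q₂ ≤ r₂, one has T(p,q) + T(q,r) ≤ T(p,r). -/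
/-- The timelike Hilbert distance of the planar model: past = closed third quadrant,
future at infinity in the first-quadrant directions. Defined for `p ≤ q` componentwise. -/
noncomputable def Tdist (p q : ℝ × ℝ) : ℝ :=
  (1 / 2) * min (Real.log (q.1 / p.1)) (Real.log (q.2 / p.2))

/-- `T` vanishes on the diagonal, is nonnegative where defined, and satisfies the time
inequality (reverse triangle inequality) along causal chains. -/
theorem stmt_7 :
    (∀ p ∈ Q, Tdist p p = 0) ∧
    (∀ p ∈ Q, ∀ q ∈ Q, p.1 ≤ q.1 → p.2 ≤ q.2 → 0 ≤ Tdist p q) ∧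
    (∀ p ∈ Q, ∀ q ∈ Q, ∀ r ∈ Q, p.1 ≤ q.1 → q.1 ≤ r.1 → p.2 ≤ q.2 → q.2 ≤ r.2 →
      Tdist p q + Tdist q r ≤ Tdist p r) := by
  refine ⟨?_, ?_, ?_⟩
  · rintro p ⟨h₁, h₂⟩
    simp [Tdist, div_self h₁.ne', div_self h₂.ne']
  · rintro p ⟨h₁, h₂⟩ q - h h'
    exact mul_nonneg (by norm_num) (le_min
      (Real.log_nonneg ((one_le_div h₁).2 h)) (Real.log_nonneg ((one_le_div h₂).2 h')))
  · rintro p ⟨hp₁, hp₂⟩ q ⟨hq₁, hq₂⟩ r ⟨hr₁, hr₂⟩ - - - -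
    unfold Tdist
    rw [← mul_add, Real.log_div hq₁.ne' hp₁.ne', Real.log_div hq₂.ne' hp₂.ne',
      Real.log_div hr₁.ne' hq₁.ne', Real.log_div hr₂.ne' hq₂.ne',
      Real.log_div hr₁.ne' hp₁.ne', Real.log_div hr₂.ne' hp₂.ne']
    refine mul_le_mul_of_nonneg_left (le_min ?_ ?_) (by norm_num)
    · exact (add_le_add (min_le_left _ _) (min_le_left _ _)).trans_eq (by ring)
    · exact (add_le_add (min_le_right _ _) (min_le_right _ _)).trans_eq (by ring)
end

section
/- Define F : ℝ² → ℝ by F(w) = (1/2)·min(w₁, w₂), restricted to the closed convex cone C = {w ∈ ℝ² : w₁ ≥ 0, w₂ ≥ 0}. Then: (i) F(λw) = λ·F(w) for all λ ≥ 0 and w ∈ C; (ii) F is superadditive on C: F(w+u) ≥ F(w) + F(u) for all w, u ∈ C; (iii) F is concave on C; (iv) F(w) > 0 if and only if w lies in the interior of C, and F vanishes exactly on the boundary of C (the light cone). Moreover, for all p, q ∈ Q with p ≤ q componentwise, T(p,q) = F(Log q − Log p), where Log(x₁,x₂) = (log x₁, log x₂); hence Log identifies (Q, T) with the timelike Minkowski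 plane (ℝ², C, F). -/
/-- The closed first-quadrant cone in `ℝ²`. -/
def Cone : Set (ℝ × ℝ) := {w | 0 ≤ w.1 ∧ 0 ≤ w.2}

/-- The timelike Minkowski functional `F(w) = (1/2) min (w₁, w₂)` on the cone. -/
noncomputable def F (w : ℝ × ℝ) : ℝ := (1 / 2) * min w.1 w.2

lemma Cone_eq_prod : Cone = Set.Ici (0 : ℝ) ×ˢ Set.Ici (0 : ℝ) := rfl

lemma F_pos_iff (w : ℝ × ℝ) : 0 < F w ↔ 0 < w.1 ∧ 0 < w.2 := by
  simp [F]

lemma interior_Cone : interior Cone = Q := by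
  rw [Cone_eq_prod, interior_prod_eq, interior_Ici]
  rfl

lemma isClosed_Cone : IsClosed Cone :=
  isClosed_Ici.prod isClosed_Ici

lemma convex_Cone : Convex ℝ Cone :=
  (convex_Ici 0).prod (convex_Ici 0)

lemma F_nonneg {w : ℝ × ℝ} (hw : w ∈ Cone) : 0 ≤ F w :=
  mul_nonneg (by norm_num) (le_min hw.1 hw.2)

lemma F_smul {l : ℝ} (hl : 0 ≤ l) (w : ℝ × ℝ) : F (l • w) = l * F w := by
  simp only [F, Prod.smul_fst, Prod.smul_snd, smul_eq_mul, ← mul_min_of_nonneg _ _ hl]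
  ring

lemma F_add_le (w u : ℝ × ℝ) : F w + F u ≤ F (w + u) := by
  simp only [F, ← mul_add, Prod.fst_add, Prod.snd_add]
  exact mul_le_mul_of_nonneg_left (min_add_min_le_min_add_add ..) (by norm_num)

/-- `F` is positively homogeneous, superadditive and concave on the cone `C`, positive
exactly on its interior and zero exactly on its boundary (the light cone); and
`Log` identifies `(Q, T)` with the timelike Minkowski plane `(ℝ², C, F)`. -/
theorem stmt_8 :
    -- (i) positive homogeneity
    (∀ l : ℝ, 0 ≤ l → ∀ w ∈ Cone, F (l • w) = l * F w) ∧
    -- (ii) superadditivity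
    (∀ w ∈ Cone, ∀ u ∈ Cone, F w + F u ≤ F (w + u)) ∧
    -- (iii) concavity
    ConcaveOn ℝ Cone F ∧
    -- (iv) positivity on the interior, vanishing on the boundary
    (∀ w ∈ Cone, (0 < F w ↔ w ∈ interior Cone)) ∧
    (∀ w ∈ Cone, (F w = 0 ↔ w ∈ frontier Cone)) ∧
    -- `Log` carries `T` to `F`
    (∀ p ∈ Q, ∀ q ∈ Q, p.1 ≤ q.1 → p.2 ≤ q.2 →
      Tdist p q = F (LogMap q - LogMap p)) := by
  refine ⟨fun l hl w _ => F_smul hl w, fun w _ u _ => F_add_le w u,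
    ⟨convex_Cone, fun w _ u _ a b ha hb _ => ?_⟩, fun w _ => ?_, fun w hw => ?_,
    fun p hp q hq _ _ => ?_⟩
  · rw [smul_eq_mul, smul_eq_mul, ← F_smul ha, ← F_smul hb]
    exact F_add_le _ _
  · rw [interior_Cone, F_pos_iff]
    rfl
  · rw [isClosed_Cone.frontier_eq, interior_Cone, Set.mem_sdiff, and_iff_right hw]
    change _ ↔ ¬(0 < w.1 ∧ 0 < w.2)
    rw [← F_pos_iff, not_lt, (F_nonneg hw).ge_iff_eq']
  · simp only [Tdist, F, LogMap, Prod.fst_sub, Prod.snd_sub,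
      Real.log_div hq.1.ne' hp.1.ne', Real.log_div hq.2.ne' hp.2.ne']
end

section
/- Let p, r ∈ Q with p₁ ≤ r₁ and p₂ ≤ r₂, and let q = (1−s)·p + s·r for some s ∈ [0,1] (so p ≤ q ≤ r componentwise and p, q, r are collinear). Then T(p,q) + T(q,r) = T(p,r), where T(u,v) = (1/2)·min(log(v₁/u₁), log(v₂/u₂)). In other words, affine line segments directed into the (closed) positive-quadrant directions are geodesics of the timelike Hilbert distance T: the distance is additive along them. -/
/-- `Tdist` is unchanged when the two coordinates are swapped. -/
theorem Tdist_swap (u v : ℝ × ℝ) : Tdist u.swap v.swap = Tdist u v := by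
  simp only [Tdist, Prod.fst_swap, Prod.snd_swap, min_comm]

/-- When the first coordinate has the smaller ratio, `Tdist` is read off from it. -/
theorem Tdist_eq_of_mul_le_mul {u v : ℝ × ℝ} (hu : u ∈ Q) (hv : v ∈ Q)
    (h : v.1 * u.2 ≤ v.2 * u.1) :
    Tdist u v = (1 / 2) * (Real.log v.1 - Real.log u.1) := by
  have hle : Real.log (v.1 / u.1) ≤ Real.log (v.2 / u.2) :=
    Real.log_le_log (div_pos hv.1 hu.1) ((div_le_div_iff₀ hu.1 hu.2).2 h)
  rw [Tdist, min_eq_left hle, Real.log_div hv.1.ne' hu.1.ne']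

theorem convex_Q : Convex ℝ Q :=
  (convex_Ioi (0 : ℝ)).prod (convex_Ioi (0 : ℝ))

/-- Additivity of `Tdist` along a segment whose endpoints have the smaller ratio in the first
coordinate. -/
theorem Tdist_add_of_mul_le_mul {p r : ℝ × ℝ} (hp : p ∈ Q) (hr : r ∈ Q)
    (h : r.1 * p.2 ≤ r.2 * p.1) {s : ℝ} (hs0 : 0 ≤ s) (hs1 : s ≤ 1) :
    Tdist p ((1 - s) • p + s • r) + Tdist ((1 - s) • p + s • r) r = Tdist p r := by
  have hq : (1 - s) • p + s • r ∈ Q :=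
    convex_Q hp hr (sub_nonneg.2 hs1) hs0 (sub_add_cancel 1 s)
  have hpq := mul_le_mul_of_nonneg_left h hs0
  have hqr := mul_le_mul_of_nonneg_left h (sub_nonneg.2 hs1)
  rw [Tdist_eq_of_mul_le_mul hp hr h, Tdist_eq_of_mul_le_mul hp hq,
    Tdist_eq_of_mul_le_mul hq hr]
  · ring
  · simp only [Prod.fst_add, Prod.snd_add, Prod.smul_fst, Prod.smul_snd, smul_eq_mul]
    linarith
  · simp only [Prod.fst_add, Prod.snd_add, Prod.smul_fst, Prod.smul_snd, smul_eq_mul]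
    linarith

/-- The timelike Hilbert distance `T` is additive along affine segments directed into the
closed positive-quadrant directions: such segments are geodesics. -/
theorem stmt_10 (p r : ℝ × ℝ) (hp : p ∈ Q) (hr : r ∈ Q)
    (h1 : p.1 ≤ r.1) (h2 : p.2 ≤ r.2)
    (s : ℝ) (hs0 : 0 ≤ s) (hs1 : s ≤ 1)
    (q : ℝ × ℝ) (hq : q = (1 - s) • p + s • r) :
    Tdist p q + Tdist q r = Tdist p r := by
  subst hq
  rcases le_total (r.1 * p.2) (r.2 * p.1) with h | h
  · exact Tdist_add_of_mul_le_mul hp hr h hs0 hs1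
  · have hswap := Tdist_add_of_mul_le_mul (p := p.swap) (r := r.swap) hp.symm hr.symm h hs0 hs1
    have hq : (1 - s) • p.swap + s • r.swap = ((1 - s) • p + s • r).swap := rfl
    rwa [hq, Tdist_swap, Tdist_swap, Tdist_swap] at hswap
end

section
/- Let p ∈ Q and let v = (v₁, v₂) ∈ ℝ² with v₁ ≥ 0 and v₂ ≥ 0. Then the limit lim_{t→0⁺} T(p, p + t·v)/t exists and equals (1/2)·min(v₁/p₁, v₂/p₂). In particular, the timelike Minkowski functional of the timelike Hilbert metric T at the point p, evaluated on a future-directed vector v, is (1/2)·min(v₁/p₁, v₂/p₂); it vanishes exactly on the lightlike directions v₁ = 0 and v₂ = 0. -/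
/-- The one-sided derivative at `0` of `t ↦ log ((a + t b) / a)` is `b / a`. -/
theorem tendsto_log_div_nhdsGT (a b : ℝ) (ha : 0 < a) :
    Filter.Tendsto (fun t : ℝ => Real.log ((a + t * b) / a) / t)
      (nhdsWithin 0 (Set.Ioi 0)) (nhds (b / a)) := by
  have h : HasDerivAt (fun t : ℝ => Real.log ((a + t * b) / a)) (b / a) 0 := by
    have h1 : HasDerivAt (fun t : ℝ => (a + t * b) / a) (b / a) 0 := by
      simpa using (((hasDerivAt_id (0 : ℝ)).mul_const b).const_add a).div_const a
    simpa [ha.ne'] using h1.log (by simp [ha.ne'])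
  refine h.tendsto_slope_zero_right.congr fun t => ?_
  simp [ha.ne', div_eq_inv_mul]

/-- The timelike Minkowski functional of `T` at `p` on a future-directed vector `v`: the
one-sided derivative `lim_{t → 0⁺} T(p, p + t v)/t` exists and equals
`(1/2) min (v₁/p₁, v₂/p₂)`, which vanishes exactly in the lightlike directions
`v₁ = 0` or `v₂ = 0`. -/
theorem stmt_11 (p : ℝ × ℝ) (hp : p ∈ Q) (v : ℝ × ℝ) (hv1 : 0 ≤ v.1) (hv2 : 0 ≤ v.2) :
    Filter.Tendsto (fun t : ℝ => Tdist p (p + t • v) / t)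
      (nhdsWithin 0 (Set.Ioi 0))
      (nhds ((1 / 2) * min (v.1 / p.1) (v.2 / p.2))) ∧
    ((1 / 2) * min (v.1 / p.1) (v.2 / p.2) = 0 ↔ v.1 = 0 ∨ v.2 = 0) := by
  obtain ⟨h1, h2⟩ := hp
  constructor
  · refine (((tendsto_log_div_nhdsGT p.1 v.1 h1).min
      (tendsto_log_div_nhdsGT p.2 v.2 h2)).const_mul (1 / 2)).congr' ?_
    filter_upwards [self_mem_nhdsWithin] with t ht
    simp only [Tdist, Prod.fst_add, Prod.snd_add, Prod.smul_fst, Prod.smul_snd, smul_eq_mul]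
    rw [min_div_div_right (le_of_lt ht), mul_div_assoc]
  · have a1 : 0 ≤ v.1 / p.1 := div_nonneg hv1 h1.le
    have a2 : 0 ≤ v.2 / p.2 := div_nonneg hv2 h2.le
    have e1 : v.1 / p.1 = 0 ↔ v.1 = 0 := by simp [h1.ne']
    have e2 : v.2 / p.2 = 0 ↔ v.2 = 0 := by simp [h2.ne']
    rw [← e1, ← e2]
    grind
end

section
/- Let s, t ∈ ℝ² with s₁ < t₁ < 0 < t₂ < s₂ and t₂/s₂ < t₁/s₁ (note that both ratios are positive, being quotients of numbers of the same sign). Then the affine line through s and t meets the negative x-axis at a point a₁ = (α, 0) with α < 0 and the negative y-axis at a point a₂ = (0, β) with β < 0, the four points occur in the order s, t, a₁, a₂ along the line, and the half-logarithm of the Euclidean cross ratio satisfies (1/2)·log( (‖t − a₂‖·‖s − a₁‖) / (‖s − a₂‖·‖t − a₁‖) ) = (1/2)·log( (t₁·s₂)/(s₁·t₂) ) = (1/2)·( log(t₁/s₁) − log(t₂/s₂) ). -/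
theorem sbtw_lineMap_of_lt {V P : Type*} [AddCommGroup V] [Module ℝ V] [AddTorsor V P]
    {p q : P} (hpq : p ≠ q) {a b c : ℝ} (hab : a < b) (hbc : b < c) :
    Sbtw ℝ (AffineMap.lineMap p q a) (AffineMap.lineMap p q b)
      (AffineMap.lineMap p q c : P) := by
  rw [(AffineMap.lineMap_injective ℝ hpq).sbtw_map_iff]
  exact .of_lt_of_lt hab hbc

/-- For `s`, `t` in the open second quadrant with `s₁ < t₁ < 0 < t₂ < s₂` and
`t₂/s₂ < t₁/s₁`, the line through `s` and `t` meets the negative `x`-axis at `a₁` and the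
negative `y`-axis at `a₂`, in the order `s, t, a₁, a₂`, and the half-logarithm of the
Euclidean cross ratio equals `(1/2)(log (t₁/s₁) - log (t₂/s₂))`. -/
theorem stmt_12 (s t : EuclideanSpace ℝ (Fin 2))
    (h1 : s 0 < t 0) (h2 : t 0 < 0) (h3 : 0 < t 1) (h4 : t 1 < s 1)
    (h5 : t 1 / s 1 < t 0 / s 0) :
    ∃ a₁ a₂ : EuclideanSpace ℝ (Fin 2),
      a₁ 0 < 0 ∧ a₁ 1 = 0 ∧ a₂ 0 = 0 ∧ a₂ 1 < 0 ∧
      a₁ ∈ affineSpan ℝ ({s, t} : Set (EuclideanSpace ℝ (Fin 2))) ∧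
      a₂ ∈ affineSpan ℝ ({s, t} : Set (EuclideanSpace ℝ (Fin 2))) ∧
      Sbtw ℝ s t a₁ ∧ Sbtw ℝ t a₁ a₂ ∧
      (1 / 2) * Real.log ((‖t - a₂‖ * ‖s - a₁‖) / (‖s - a₂‖ * ‖t - a₁‖))
        = (1 / 2) * Real.log ((t 0 * s 1) / (s 0 * t 1)) ∧
      (1 / 2) * Real.log ((t 0 * s 1) / (s 0 * t 1))
        = (1 / 2) * (Real.log (t 0 / s 0) - Real.log (t 1 / s 1)) := by
  have hs0 : s 0 < 0 := h1.trans h2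
  have hs1 : 0 < s 1 := h3.trans h4
  have hd0 : s 0 - t 0 < 0 := sub_neg.2 h1
  have hd1 : 0 < s 1 - t 1 := sub_pos.2 h4
  have hcross : t 0 * s 1 < t 1 * s 0 := by
    rw [lt_div_iff_of_neg hs0, div_mul_eq_mul_div, lt_div_iff₀ hs1] at h5
    exact h5
  have hst : s ≠ t := fun h => h1.ne (by rw [h])
  have hlam : 1 < s 1 / (s 1 - t 1) := by rw [one_lt_div hd1]; linarith
  have hlt : s 1 / (s 1 - t 1) < s 0 / (s 0 - t 0) := by
    rw [lt_div_iff_of_neg hd0, div_mul_eq_mul_div, lt_div_iff₀ hd1]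
    linarith
  have hsub_t (r : ℝ) (hr : 1 < r) :
      ‖t - AffineMap.lineMap s t r‖ = (r - 1) * ‖s - t‖ := by
    rw [← dist_eq_norm, dist_right_lineMap, Real.norm_of_nonpos (by linarith), dist_eq_norm]
    ring
  have hsub_s (r : ℝ) (hr : 1 < r) :
      ‖s - AffineMap.lineMap s t r‖ = r * ‖s - t‖ := by
    rw [← dist_eq_norm, dist_left_lineMap, Real.norm_of_nonneg (by linarith), dist_eq_norm]
  have hcoord (r : ℝ) (i : Fin 2) :
      (AffineMap.lineMap s t r : EuclideanSpace ℝ (Fin 2)) i = r * (t i - s i) + s i := by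
    simp [AffineMap.lineMap_apply]
  refine ⟨AffineMap.lineMap s t (s 1 / (s 1 - t 1)), AffineMap.lineMap s t (s 0 / (s 0 - t 0)),
    ?_, ?_, ?_, ?_, AffineMap.lineMap_mem_affineSpan_pair _ _ _,
    AffineMap.lineMap_mem_affineSpan_pair _ _ _, ?_, ?_, ?_, ?_⟩
  · rw [hcoord]
    have := mul_lt_mul_of_neg_right hlt hd0
    rw [div_mul_cancel₀ _ hd0.ne] at this
    linarith
  · rw [hcoord]
    field_simp
    ring
  · rw [hcoord]
    have := hd0.ne
    field_simp
    ring
  · rw [hcoord]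
    have := mul_lt_mul_of_pos_right hlt hd1
    rw [div_mul_cancel₀ _ hd1.ne'] at this
    linarith
  · simpa using sbtw_lineMap_of_lt hst one_pos hlam
  · simpa using sbtw_lineMap_of_lt hst hlam hlt
  · have hn : ‖s - t‖ ≠ 0 := norm_ne_zero_iff.2 (sub_ne_zero.2 hst)
    have e0 : s 0 / (s 0 - t 0) - 1 = t 0 / (s 0 - t 0) := by
      rw [div_sub_one hd0.ne, sub_sub_cancel]
    have e1 : s 1 / (s 1 - t 1) - 1 = t 1 / (s 1 - t 1) := by
      rw [div_sub_one hd1.ne', sub_sub_cancel]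
    rw [hsub_t _ (hlam.trans hlt), hsub_t _ hlam, hsub_s _ (hlam.trans hlt), hsub_s _ hlam, e0, e1]
    have := hd0.ne
    have := hs0.ne
    congr 2
    field_simp
  · rw [← Real.log_div (div_pos_of_neg_of_neg h2 hs0).ne' (div_pos h3 hs1).ne', div_div_div_eq]
end

section
/- Let p ∈ Q and v ∈ ℝ². Then the limit lim_{t→0⁺} H(p, p + t·v)/t exists and equals (1/2)·max{ |v₁/p₁|, |v₂/p₂|, |v₁/p₁ − v₂/p₂| } = N(v₁/p₁, v₂/p₂). In particular, the Minkowski functional (infinitesimal Finsler norm) of the Hilbert metric H of the quadrant at the point p is obtained from the fixed norm N by the coordinatewise rescaling v ↦ (v₁/p₁, v₂/p₂), so the Finsler structure of (Q, H) is the pullback of the norm N under the map Log(x₁,x₂) = (log x₁, log x₂). -/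
/-- The quotient of `Hdist p q` by a positive number, in terms of logarithmic coordinates. -/
theorem Hdist_div_of_mem_Q {p q : ℝ × ℝ} (hp : p ∈ Q) (hq : q ∈ Q) {t : ℝ} (ht : 0 < t) :
    Hdist p q / t = N ((Real.log q.1 - Real.log p.1) / t, (Real.log q.2 - Real.log p.2) / t) := by
  obtain ⟨hp₁, hp₂⟩ := hp
  obtain ⟨hq₁, hq₂⟩ := hq
  have hdiff : Real.log ((p.1 * q.2) / (q.1 * p.2))
      = -((Real.log q.1 - Real.log p.1) - (Real.log q.2 - Real.log p.2)) := by
    rw [Real.log_div (by positivity) (by positivity), Real.log_mul hp₁.ne' hq₂.ne',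
      Real.log_mul hq₁.ne' hp₂.ne']
    ring
  rw [Hdist, N, hdiff, abs_neg, Real.log_div hp₁.ne' hq₁.ne', Real.log_div hp₂.ne' hq₂.ne',
    abs_sub_comm (Real.log p.1), abs_sub_comm (Real.log p.2), ← sub_div]
  simp only [abs_div, abs_of_pos ht, max_div_div_right ht.le, mul_div_assoc]

theorem tendsto_log_add_mul_sub_log_div {a : ℝ} (ha : 0 < a) (b : ℝ) :
    Filter.Tendsto (fun t : ℝ => (Real.log (a + t * b) - Real.log a) / t)
      (nhdsWithin 0 (Set.Ioi 0)) (nhds (b / a)) := by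
  have h : HasDerivAt (fun t : ℝ => Real.log (a + t * b)) (b / a) 0 := by
    have h_lin : HasDerivAt (fun t : ℝ => a + t * b) b 0 := by
      simpa using ((hasDerivAt_id (0 : ℝ)).mul_const b).const_add a
    simpa using h_lin.log (by simpa using ha.ne')
  simpa [div_eq_inv_mul] using h.tendsto_slope_zero_right

theorem eventually_add_mul_pos {a : ℝ} (ha : 0 < a) (b : ℝ) :
    ∀ᶠ t : ℝ in nhdsWithin 0 (Set.Ioi 0), 0 < a + t * b := by
  have h : Continuous fun t : ℝ => a + t * b := by fun_prop
  exact nhdsWithin_le_nhds (h.continuousAt.eventually_const_lt (by simpa using ha))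

/-- The Minkowski functional of the Hilbert metric `H` of the quadrant at `p` in direction
`v`: the one-sided derivative `lim_{t → 0⁺} H(p, p + t v)/t` exists and equals
`(1/2) max {|v₁/p₁|, |v₂/p₂|, |v₁/p₁ - v₂/p₂|} = N(v₁/p₁, v₂/p₂)`, the pullback of the
norm `N` under the coordinatewise rescaling. -/
theorem stmt_14 (p : ℝ × ℝ) (hp : p ∈ Q) (v : ℝ × ℝ) :
    Filter.Tendsto (fun t : ℝ => Hdist p (p + t • v) / t)
      (nhdsWithin 0 (Set.Ioi 0))
      (nhds ((1 / 2) * max (max |v.1 / p.1| |v.2 / p.2|) |v.1 / p.1 - v.2 / p.2|)) ∧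
    (1 / 2) * max (max |v.1 / p.1| |v.2 / p.2|) |v.1 / p.1 - v.2 / p.2|
      = N (v.1 / p.1, v.2 / p.2) := by
  refine ⟨?_, rfl⟩
  have h₁ := tendsto_log_add_mul_sub_log_div hp.1 v.1
  have h₂ := tendsto_log_add_mul_sub_log_div hp.2 v.2
  refine (((h₁.abs.max h₂.abs).max (h₁.sub h₂).abs).const_mul (1 / 2)).congr' ?_
  filter_upwards [self_mem_nhdsWithin, eventually_add_mul_pos hp.1 v.1,
    eventually_add_mul_pos hp.2 v.2] with t (ht : 0 < t) hq₁ hq₂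
  exact (Hdist_div_of_mem_Q hp (q := p + t • v) ⟨hq₁, hq₂⟩ ht).symm
end
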